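/- The largest minimum weight d_{4,DT}(n) among all double Toeplitz [n, n/2] codes over F_4 satisfies: d_{4,DT}(16) = 6, d_{4,DT}(18) = 7, d_{4,DT}(20) = 8, d_{4,DT}(22) = 8, and d_{4,DT}(24) = 9. That is, for each such n there exists an (n/2)×(n/2) Toeplitz matrix A over F_4 with C(A) of minimum weight equal to the stated value, and no such Toeplitz matrix yields a code of larger minimum weight. -/

import Mathlib

open Matrix

/-- An `m × m` matrix is Toeplitz if its entries are constant along diagonals. -/
def IsToeplitz {m : ℕ} {F : Type*} (A : Matrix (Fin m) (Fin m) F) : Prop :=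
  ∀ i j i' j' : Fin m, (i : ℕ) + (j' : ℕ) = (i' : ℕ) + (j : ℕ) → A i j = A i' j'

/-- The double Toeplitz code `C(A) = {(x, xA) : x ∈ F^m}`. -/
def DTcode {m : ℕ} {F : Type*} [Field F] (A : Matrix (Fin m) (Fin m) F) :
    Set (Fin m ⊕ Fin m → F) :=
  {c | ∃ x : Fin m → F, c = Sum.elim x (Matrix.vecMul x A)}

/-- The Hamming weight of a vector: the number of nonzero coordinates. -/
noncomputable def wt {ι : Type*} [Fintype ι] {F : Type*} [Zero F] (v : ι → F) : ℕ :=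
  Nat.card {i // v i ≠ 0}

/-- The largest minimum weight among all double Toeplitz `[2m, m]` codes over
`F` equals `d`: some Toeplitz `A` gives `C(A)` of minimum weight exactly `d`,
and every Toeplitz `A` gives a code with a nonzero codeword of weight `≤ d`. -/
def DTlargestEq (F : Type*) [Field F] (m d : ℕ) : Prop :=
  (∃ A : Matrix (Fin m) (Fin m) F, IsToeplitz A ∧
    IsLeast {w | ∃ c ∈ DTcode A, c ≠ 0 ∧ wt c = w} d) ∧
  ∀ A : Matrix (Fin m) (Fin m) F, IsToeplitz A →
    ∃ c ∈ DTcode A, c ≠ 0 ∧ wt c ≤ d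

/-! ## Packed depth-first search -/

/-- Multiplication of `F_4` on the codes `0, 1, 2 = ω, 3 = ω²` (addition is bitwise xor). -/
def mul4 (a b : ℕ) : ℕ :=
  Nat.rec 0 (fun a' _ => Nat.rec 0 (fun b' _ => (a' + b') % 3 + 1) b) a

/-- All coefficient lists of length `n`. -/
def allCoefs : ℕ → List (List ℕ)
  | 0 => [[]]
  | n + 1 => (allCoefs n).flatMap fun l => [0 :: l, 1 :: l, 2 :: l, 3 :: l]

/-- The polynomials `1 + p₁ X + ⋯ + p_b X^b`, `b ≤ 5`, used to prune the search. -/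
def fields : List (List ℕ) := (List.range 6).flatMap allCoefs

def coef (f : List ℕ) (k : ℕ) : ℕ := (1 :: f).getD k 0

/-- Number of nonzero coefficients of a list. -/
def wtL (f : List ℕ) : ℕ := List.rec 0 (fun a _ n => (if a = 0 then 0 else 1) + n) f

/-- Pack the values `g f` into the hexadecimal digits of one natural number. -/
def pk {α : Type} (fs : List α) (g : α → ℕ) : ℕ :=
  List.rec 0 (fun f _ ih => g f + 16 * ih) fs

def startF (e : ℕ) (f : List ℕ) : ℕ := 7 - (e + wtL (1 :: f))
def highF (e : ℕ) (f : List ℕ) : ℕ := if e + wtL (1 :: f) ≤ 7 then 8 else 0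
def actF (m l : ℕ) (f : List ℕ) : ℕ := if f.length ≤ l ∧ l < f.length + m then 1 else 0

/-- Closed form of the packed table of the values `p_i * a`. -/
def tabC (i a : ℕ) : ℕ :=
  List.rec 0 (fun b _ ih => cond (Nat.ble i b)
    (16 ^ ((4 ^ b - 1) / 3) * (((16 ^ 4 ^ (i - 1) - 1) / 15) *
      (mul4 1 a * 16 ^ 4 ^ (i - 1) + mul4 2 a * 16 ^ (2 * 4 ^ (i - 1)) +
        mul4 3 a * 16 ^ (3 * 4 ^ (i - 1))) * ((16 ^ 4 ^ b - 1) / (16 ^ 4 ^ i - 1)))) 0 + ih)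
    [0, 1, 2, 3, 4, 5]

/-- Closed form of the packed table of active fields. -/
def actC (m l : ℕ) : ℕ :=
  List.rec 0 (fun b _ ih => cond (and (Nat.ble b l) (Nat.blt l (b + m)))
    (16 ^ ((4 ^ b - 1) / 3) * ((16 ^ 4 ^ b - 1) / 15)) 0 + ih) [0, 1, 2, 3, 4, 5]

/-- Inner product of a coefficient list with a reversed word. -/
def dot (p t : List ℕ) : ℕ :=
  List.rec (motive := fun _ => List ℕ → ℕ) (fun _ => 0)
    (fun a _ ih t => List.rec 0 (fun b t' _ => Nat.xor (mul4 a b) (ih t')) t) p t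

/-- Number of zero outputs of the filter `p` along the reversed word `t`. -/
def zc (p t : List ℕ) : ℕ :=
  List.rec 0 (fun a t' ih =>
    (if p.length ≤ t'.length + 1 ∧ dot p (a :: t') = 0 then 1 else 0) + ih) t

/-- A complete word is discarded if one of the filters in `ps` has too many zero outputs. -/
def leafC (e : ℕ) (ps : List (List ℕ)) (t : List ℕ) : Bool :=
  ps.any fun p => decide (e + wtL p < zc p t)

def x11 : ℕ := tabC 1 1
def x12 : ℕ := tabC 1 2
def x13 : ℕ := tabC 1 3
def x21 : ℕ := tabC 2 1
def x22 : ℕ := tabC 2 2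
def x23 : ℕ := tabC 2 3
def x31 : ℕ := tabC 3 1
def x32 : ℕ := tabC 3 2
def x33 : ℕ := tabC 3 3
def x41 : ℕ := tabC 4 1
def x42 : ℕ := tabC 4 2
def x43 : ℕ := tabC 4 3
def x51 : ℕ := tabC 5 1
def x52 : ℕ := tabC 5 2
def x53 : ℕ := tabC 5 3

/-- The search: `lv` lists the packed active fields of the remaining levels, `C` holds the packed
counters, `r1, …, r5` the packed partial outputs, `w` the reversed word. The value `true` means
that every continuation has been discarded. -/
noncomputable def search (H : ℕ) (leaf : List ℕ → Bool) (lv : List ℕ) :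
    ℕ → ℕ → ℕ → ℕ → ℕ → ℕ → List ℕ → Bool :=
  List.rec (motive := fun _ => ℕ → ℕ → ℕ → ℕ → ℕ → ℕ → List ℕ → Bool)
    (fun _ _ _ _ _ _ w => leaf w)
    (fun A _ ih C r1 r2 r3 r4 r5 w =>
      (fun x0 x1 =>
        (fun z3 =>
          (fun z2 =>
            and ((fun D => cond (Nat.beq (Nat.land D H) 0) (ih D r2 r3 r4 r5 0 (0 :: w)) true)
                (Nat.add C (Nat.xor A (Nat.xor x0 z2))))
            (and ((fun D => cond (Nat.beq (Nat.land D H) 0)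
                  (ih D (Nat.xor r2 x11) (Nat.xor r3 x21) (Nat.xor r4 x31) (Nat.xor r5 x41) x51
                    (1 :: w)) true)
                (Nat.add C (Nat.xor x0 z3)))
            (and ((fun D => cond (Nat.beq (Nat.land D H) 0)
                  (ih D (Nat.xor r2 x12) (Nat.xor r3 x22) (Nat.xor r4 x32) (Nat.xor r5 x42) x52
                    (2 :: w)) true)
                (Nat.add C z2))
            ((fun D => cond (Nat.beq (Nat.land D H) 0)
                  (ih D (Nat.xor r2 x13) (Nat.xor r3 x23) (Nat.xor r4 x33) (Nat.xor r5 x43) x53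
                    (3 :: w)) true)
                (Nat.add C z3)))))
          (Nat.xor x1 z3))
        (Nat.land x0 x1))
      (Nat.land r1 A) (Nat.div (Nat.land r1 (Nat.mul 2 A)) 2)) lv

/-- The fields of `r` with value `a`, among the active fields `A`. -/
def eqTo (A r a : ℕ) : ℕ :=
  (fun x0 x1 => (fun z3 => (fun z2 =>
    Nat.rec (Nat.xor A (Nat.xor x0 z2)) (fun a' _ => Nat.rec (Nat.xor x0 z3)
      (fun a'' _ => Nat.rec z2 (fun _ _ => z3) a'') a') a)
    (Nat.xor x1 z3)) (Nat.land x0 x1)) (Nat.land r A) (Nat.div (Nat.land r (Nat.mul 2 A)) 2)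

/-- Search below a prescribed prefix. -/
noncomputable def presearch (H : ℕ) (leaf : List ℕ → Bool) (as : List ℕ) :
    List ℕ → ℕ → ℕ → ℕ → ℕ → ℕ → ℕ → List ℕ → Bool :=
  List.rec (motive := fun _ => List ℕ → ℕ → ℕ → ℕ → ℕ → ℕ → ℕ → List ℕ → Bool)
    (fun lv => search H leaf lv)
    (fun a _ ih lv C r1 r2 r3 r4 r5 w =>
      List.rec (leaf w) (fun A lv' _ =>
        (fun D => cond (Nat.beq (Nat.land D H) 0)
          (ih lv' D (Nat.xor r2 (tabC 1 a)) (Nat.xor r3 (tabC 2 a)) (Nat.xor r4 (tabC 3 a))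
            (Nat.xor r5 (tabC 4 a)) (tabC 5 a) (a :: w)) true)
        (Nat.add C (eqTo A r1 a))) lv) as

/-- The search with all parameters: window length `m`, excess `e`, word length `L`. -/
noncomputable def run (m e L : ℕ) (ps : List (List ℕ)) (as : List ℕ) : Bool :=
  presearch (pk fields (highF e)) (leafC e ps) as ((List.range' 0 L).map (actC m))
    (pk fields (startF e)) 0 0 0 0 0 []

def ps8 : List (List ℕ) := [[1, 0, 0, 1, 0, 0, 1], [1, 0, 0, 2, 0, 0, 3]]

def ps11 : List (List ℕ) :=
  [[1, 0, 0, 0, 0, 1, 3], [1, 0, 0, 1, 0, 0, 3], [1, 0, 0, 2, 0, 0, 2], [1, 0, 0, 1, 0, 0, 2],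
    [1, 0, 0, 3, 0, 0, 3], [1, 0, 0, 0, 0, 0, 2], [1, 0, 0, 0, 0, 0, 3], [1, 2, 0, 0, 0, 0, 1],
    [1, 0, 1, 0, 0, 0, 2], [1, 0, 1, 0, 0, 0, 3]]

theorem tab_eq : ∀ i ∈ [1, 2, 3, 4, 5], ∀ a ∈ [0, 1, 2, 3],
    tabC i a = pk fields fun f => mul4 (coef f i) a := by
  decide +kernel

theorem act_eq8 : ∀ l ∈ List.range' 0 13, actC 8 l = pk fields (actF 8 l) := by
  decide +kernel

theorem act_eq11 : ∀ l ∈ List.range' 0 16, actC 11 l = pk fields (actF 11 l) := by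
  decide +kernel

theorem run8 : ∀ as ∈ [[0, 0, 0, 0], [0, 0, 0, 1], [0, 0, 1, 0], [0, 0, 1, 1], [0, 1, 0, 0],
    [0, 1, 0, 1], [0, 1, 1, 0], [0, 1, 1, 1], [0, 1, 1, 2], [1, 1, 1], [1, 1, 2]],
    run 8 1 13 ps8 as = true := by
  decide +kernel

theorem run11_a : ∀ as ∈ [[0, 0, 0, 0], [0, 0, 0, 1], [0, 0, 1, 0], [0, 0, 1, 1], [0, 1, 0, 0]],
    run 11 2 16 ps11 as = true := by
  decide +kernel

theorem run11_b : run 11 2 16 ps11 [0, 1, 0, 1] = true := by decide +kernel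

theorem run11_c : run 11 2 16 ps11 [0, 1, 1, 0] = true := by decide +kernel

theorem run11_d : run 11 2 16 ps11 [0, 1, 1, 1] = true := by decide +kernel

theorem run11_e : run 11 2 16 ps11 [0, 1, 1, 2] = true := by decide +kernel

theorem run11_f : run 11 2 16 ps11 [1, 1, 1, 0] = true := by decide +kernel

theorem run11_g : run 11 2 16 ps11 [1, 1, 1, 1] = true := by decide +kernel

theorem run11_h : run 11 2 16 ps11 [1, 1, 1, 2] = true := by decide +kernel

theorem run11_i : ∀ as ∈ [[1, 1, 2, 1, 1, 2], [1, 1, 2, 2, 3, 2], [1, 1, 2, 1, 2, 1],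
    [1, 1, 2, 2, 1, 1], [1, 1, 2, 1, 1, 3], [1, 1, 2, 2, 3, 3], [1, 1, 2, 1, 2, 2],
    [1, 1, 2, 2, 1, 2]], run 11 2 16 ps11 as = true := by
  decide +kernel

/-! ## Packed arithmetic -/

theorem pk_nil {α : Type} (g : α → ℕ) : pk [] g = 0 := rfl

theorem pk_cons {α : Type} (f : α) (fs : List α) (g : α → ℕ) :
    pk (f :: fs) g = g f + 16 * pk fs g := rfl

theorem xor_split {a b : ℕ} (x y : ℕ) (ha : a < 16) (hb : b < 16) :
    (a + 16 * x) ^^^ (b + 16 * y) = (a ^^^ b) + 16 * (x ^^^ y) := by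
  have h1 := Nat.xor_mod_two_pow (a := a + 16 * x) (b := b + 16 * y) (n := 4)
  have h2 := Nat.xor_div_two_pow (a := a + 16 * x) (b := b + 16 * y) (n := 4)
  norm_num at h1 h2
  rw [Nat.mod_eq_of_lt ha, Nat.mod_eq_of_lt hb] at h1
  rw [show (a + 16 * x) / 16 = x by omega, show (b + 16 * y) / 16 = y by omega] at h2
  omega

theorem and_split {a b : ℕ} (x y : ℕ) (ha : a < 16) (hb : b < 16) :
    (a + 16 * x) &&& (b + 16 * y) = (a &&& b) + 16 * (x &&& y) := by
  have h1 := Nat.and_mod_two_pow (a := a + 16 * x) (b := b + 16 * y) (n := 4)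
  have h2 := Nat.and_div_two_pow (a := a + 16 * x) (b := b + 16 * y) (n := 4)
  norm_num at h1 h2
  rw [Nat.mod_eq_of_lt ha, Nat.mod_eq_of_lt hb] at h1
  rw [show (a + 16 * x) / 16 = x by omega, show (b + 16 * y) / 16 = y by omega] at h2
  omega

theorem pk_xor {α : Type} (fs : List α) (g h : α → ℕ) (hg : ∀ f ∈ fs, g f < 16)
    (hh : ∀ f ∈ fs, h f < 16) :
    Nat.xor (pk fs g) (pk fs h) = pk fs fun f => g f ^^^ h f := by
  induction fs with
  | nil => exact Nat.xor_self 0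
  | cons f fs ih =>
    simp only [List.mem_cons, forall_eq_or_imp] at hg hh
    rw [pk_cons, pk_cons, pk_cons, ← ih hg.2 hh.2]
    exact xor_split _ _ hg.1 hh.1

theorem pk_and {α : Type} (fs : List α) (g h : α → ℕ) (hg : ∀ f ∈ fs, g f < 16)
    (hh : ∀ f ∈ fs, h f < 16) :
    Nat.land (pk fs g) (pk fs h) = pk fs fun f => g f &&& h f := by
  induction fs with
  | nil => exact Nat.and_self 0
  | cons f fs ih =>
    simp only [List.mem_cons, forall_eq_or_imp] at hg hh
    rw [pk_cons, pk_cons, pk_cons, ← ih hg.2 hh.2]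
    exact and_split _ _ hg.1 hh.1

theorem pk_add {α : Type} (fs : List α) (g h : α → ℕ) :
    Nat.add (pk fs g) (pk fs h) = pk fs fun f => g f + h f := by
  induction fs with
  | nil => rfl
  | cons f fs ih =>
    have ih' : pk fs g + pk fs h = pk fs fun f => g f + h f := ih
    rw [pk_cons, pk_cons, pk_cons, ← ih']
    change (g f + 16 * pk fs g) + (h f + 16 * pk fs h) = _
    ring

theorem pk_two {α : Type} (fs : List α) (g : α → ℕ) :
    Nat.mul 2 (pk fs g) = pk fs fun f => 2 * g f := by
  induction fs with
  | nil => rfl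
  | cons f fs ih =>
    have ih' : 2 * pk fs g = pk fs fun f => 2 * g f := ih
    rw [pk_cons, pk_cons, ← ih']
    change 2 * _ = _
    ring

theorem pk_congr {α : Type} (fs : List α) (g h : α → ℕ) (H : ∀ f ∈ fs, g f = h f) :
    pk fs g = pk fs h := by
  induction fs with
  | nil => rfl
  | cons f fs ih =>
    simp only [List.mem_cons, forall_eq_or_imp] at H
    rw [pk_cons, pk_cons, H.1, ih H.2]

theorem pk_half {α : Type} (fs : List α) (g h : α → ℕ) (H : ∀ f ∈ fs, g f = 2 * h f) :
    Nat.div (pk fs g) 2 = pk fs h := by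
  rw [pk_congr fs g (fun f => 2 * h f) H, ← pk_two]
  change 2 * pk fs h / 2 = _
  omega

theorem pk_zero {α : Type} (fs : List α) : pk fs (fun _ => 0) = 0 := by
  induction fs with
  | nil => rfl
  | cons f fs ih => rw [pk_cons, ih]

theorem mul4_lt (a b : ℕ) : mul4 a b < 4 := by
  unfold mul4
  cases a with
  | zero => simp
  | succ a =>
    cases b with
    | zero => simp
    | succ b => simp only; omega

theorem xor_lt4 {a b : ℕ} (ha : a < 4) (hb : b < 4) : a ^^^ b < 4 :=
  Nat.xor_lt_two_pow (n := 2) ha hb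

theorem eqTo_pk {α : Type} (fs : List α) (act r : α → ℕ) (a : ℕ) (ha : a < 4)
    (hact : ∀ f ∈ fs, act f ≤ 1) (hr : ∀ f ∈ fs, r f < 4) :
    eqTo (pk fs act) (pk fs r) a = pk fs fun f => if act f = 1 ∧ r f = a then 1 else 0 := by
  have e0 : Nat.land (pk fs r) (pk fs act) = pk fs fun f => r f &&& act f :=
    pk_and _ _ _ (fun f hf => by have := hr f hf; omega) (fun f hf => by have := hact f hf; omega)
  have e1 : Nat.div (Nat.land (pk fs r) (Nat.mul 2 (pk fs act))) 2 =
      pk fs fun f => (r f / 2) &&& act f := by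
    rw [pk_two, pk_and _ _ _ (fun f hf => by have := hr f hf; omega)
      (fun f hf => by have := hact f hf; omega)]
    apply pk_half
    intro f hf
    have h1 := hr f hf
    have h2 := hact f hf
    generalize r f = x at *
    generalize act f = y at *
    interval_cases x <;> interval_cases y <;> rfl
  have l0 : ∀ f ∈ fs, r f &&& act f < 16 := fun f hf =>
    lt_of_le_of_lt Nat.and_le_left (by have := hr f hf; omega)
  have l1 : ∀ f ∈ fs, (r f / 2) &&& act f < 16 := fun f hf =>
    lt_of_le_of_lt Nat.and_le_left (by have := hr f hf; omega)
  have e3 := pk_and fs _ _ l0 l1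
  have l3 : ∀ f ∈ fs, (r f &&& act f) &&& ((r f / 2) &&& act f) < 16 := fun f hf =>
    lt_of_le_of_lt Nat.and_le_left (l0 f hf)
  have e2 := pk_xor fs _ _ l1 l3
  have l2 : ∀ f ∈ fs, ((r f / 2) &&& act f) ^^^ ((r f &&& act f) &&& ((r f / 2) &&& act f)) < 16 :=
    fun f hf => Nat.xor_lt_two_pow (n := 4) (l1 f hf) (l3 f hf)
  have e4 := pk_xor fs _ _ l0 l3
  have e5 := pk_xor fs _ _ l0 l2
  have e6 := pk_xor fs act _ (fun f hf => by have := hact f hf; omega)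
    (fun f hf => Nat.xor_lt_two_pow (n := 4) (l0 f hf) (l2 f hf))
  unfold eqTo
  simp only [e0, e1, e2, e3, e4, e5, e6]
  interval_cases a
  all_goals
    apply pk_congr
    intro f hf
    have h1 := hr f hf
    have h2 := hact f hf
    generalize r f = x at *
    generalize act f = y at *
    interval_cases x <;> interval_cases y <;> rfl

theorem wtL_cons (a : ℕ) (f : List ℕ) : wtL (a :: f) = (if a = 0 then 0 else 1) + wtL f := rfl

theorem fields_prop : ∀ f ∈ fields, f.length ≤ 5 ∧ (∀ a ∈ f, a < 4) ∧ wtL (1 :: f) ≤ 6 := by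
  decide +kernel

theorem tab0 : tabC 1 0 = 0 ∧ tabC 2 0 = 0 ∧ tabC 3 0 = 0 ∧ tabC 4 0 = 0 ∧ tabC 5 0 = 0 := by
  decide +kernel

theorem xor0 (r : ℕ) : Nat.xor r 0 = r := Nat.xor_zero r

theorem search_child (H : ℕ) (leaf : List ℕ → Bool) (A : ℕ) (lv : List ℕ)
    (C r1 r2 r3 r4 r5 : ℕ) (w : List ℕ) (a : ℕ) (ha : a < 4)
    (h0 : Nat.land (Nat.add C (eqTo A r1 a)) H = 0)
    (h : search H leaf lv (Nat.add C (eqTo A r1 a)) (Nat.xor r2 (tabC 1 a)) (Nat.xor r3 (tabC 2 a))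
      (Nat.xor r4 (tabC 3 a)) (Nat.xor r5 (tabC 4 a)) (tabC 5 a) (a :: w) = false) :
    search H leaf (A :: lv) C r1 r2 r3 r4 r5 w = false := by
  have key : ∀ (a : ℕ), Nat.land (Nat.add C (eqTo A r1 a)) H = 0 →
      search H leaf lv (Nat.add C (eqTo A r1 a)) (Nat.xor r2 (tabC 1 a)) (Nat.xor r3 (tabC 2 a))
      (Nat.xor r4 (tabC 3 a)) (Nat.xor r5 (tabC 4 a)) (tabC 5 a) (a :: w) = false →
      cond (Nat.beq (Nat.land (Nat.add C (eqTo A r1 a)) H) 0)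
      (search H leaf lv (Nat.add C (eqTo A r1 a)) (Nat.xor r2 (tabC 1 a)) (Nat.xor r3 (tabC 2 a))
      (Nat.xor r4 (tabC 3 a)) (Nat.xor r5 (tabC 4 a)) (tabC 5 a) (a :: w)) true = false := by
    intro a h0 h
    rw [h0, h]
    rfl
  have e : search H leaf (A :: lv) C r1 r2 r3 r4 r5 w =
    and (cond (Nat.beq (Nat.land (Nat.add C (eqTo A r1 0)) H) 0)
      (search H leaf lv (Nat.add C (eqTo A r1 0)) r2 r3 r4 r5 0 (0 :: w)) true)
    (and (cond (Nat.beq (Nat.land (Nat.add C (eqTo A r1 1)) H) 0)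
      (search H leaf lv (Nat.add C (eqTo A r1 1)) (Nat.xor r2 (tabC 1 1)) (Nat.xor r3 (tabC 2 1))
      (Nat.xor r4 (tabC 3 1)) (Nat.xor r5 (tabC 4 1)) (tabC 5 1) (1 :: w)) true)
    (and (cond (Nat.beq (Nat.land (Nat.add C (eqTo A r1 2)) H) 0)
      (search H leaf lv (Nat.add C (eqTo A r1 2)) (Nat.xor r2 (tabC 1 2)) (Nat.xor r3 (tabC 2 2))
      (Nat.xor r4 (tabC 3 2)) (Nat.xor r5 (tabC 4 2)) (tabC 5 2) (2 :: w)) true)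
    (cond (Nat.beq (Nat.land (Nat.add C (eqTo A r1 3)) H) 0)
      (search H leaf lv (Nat.add C (eqTo A r1 3)) (Nat.xor r2 (tabC 1 3)) (Nat.xor r3 (tabC 2 3))
      (Nat.xor r4 (tabC 3 3)) (Nat.xor r5 (tabC 4 3)) (tabC 5 3) (3 :: w)) true))) := rfl
  have k := key a h0 h
  rw [e]
  interval_cases a
  · rw [tab0.1, tab0.2.1, tab0.2.2.1, tab0.2.2.2.1, tab0.2.2.2.2, xor0, xor0, xor0, xor0] at k
    rw [k]; rfl
  · rw [k]; simp
  · rw [k]; simp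
  · rw [k]; simp

/-! ## Soundness of the search along a word `c` -/

/-- Partial outputs. -/
def reg (c : ℕ → ℕ) (f : List ℕ) : ℕ → ℕ → ℕ
  | _, 0 => 0
  | k, l + 1 => reg c f (k + 1) l ^^^ mul4 (coef f k) (c l)

/-- Number of zero outputs in the active window before time `l`. -/
def cnt (m : ℕ) (c : ℕ → ℕ) (f : List ℕ) : ℕ → ℕ
  | 0 => 0
  | l + 1 => cnt m c f l + if actF m l f = 1 ∧ reg c f 1 l = c l then 1 else 0

/-- The reversed word. -/
def path (c : ℕ → ℕ) : ℕ → List ℕ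
  | 0 => []
  | l + 1 => c l :: path c l

theorem reg_lt (c : ℕ → ℕ) (f : List ℕ) (l : ℕ) : ∀ k, reg c f k l < 4 := by
  induction l with
  | zero => intro k; simp [reg]
  | succ l ih => intro k; exact xor_lt4 (ih _) (mul4_lt _ _)

theorem coef_zero {f : List ℕ} {k : ℕ} (h : f.length < k) : coef f k = 0 := by
  unfold coef
  rw [List.getD_eq_default]
  simpa using h

theorem reg_zero (c : ℕ → ℕ) (f : List ℕ) (l : ℕ) : ∀ k, f.length < k → reg c f k l = 0 := by
  induction l with
  | zero => intro k _; rfl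
  | succ l ih =>
    intro k hk
    simp only [reg]
    rw [ih _ (by omega), coef_zero hk]
    exact Nat.xor_self 0

theorem reg_pack (c : ℕ → ℕ) (hc : ∀ l, c l < 4) (l k : ℕ) (hk : k ∈ [1, 2, 3, 4, 5]) :
    Nat.xor (pk fields fun f => reg c f (k + 1) l) (tabC k (c l)) =
      pk fields fun f => reg c f k (l + 1) := by
  rw [tab_eq k hk (c l) (by have := hc l; simp; omega), pk_xor]
  · rfl
  · intro f _
    have := reg_lt c f l (k + 1)
    omega
  · intro f _
    have := mul4_lt (coef f k) (c l)
    omega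

theorem reg_pack5 (c : ℕ → ℕ) (hc : ∀ l, c l < 4) (l : ℕ) :
    tabC 5 (c l) = pk fields fun f => reg c f 5 (l + 1) := by
  rw [← reg_pack c hc l 5 (by simp), pk_congr fields _ (fun _ => 0), pk_zero]
  · exact (Nat.zero_xor _).symm
  · intro f hf
    exact reg_zero _ _ _ _ (by have := (fields_prop f hf).1; omega)

theorem cnt_pack (m e L : ℕ) (c : ℕ → ℕ) (hc : ∀ l, c l < 4)
    (hact : ∀ l ∈ List.range' 0 L, actC m l = pk fields (actF m l))
    (l : ℕ) (hl : l < L) :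
    Nat.add (pk fields fun f => startF e f + cnt m c f l)
      (eqTo (actC m l) (pk fields fun f => reg c f 1 l) (c l)) =
        pk fields fun f => startF e f + cnt m c f (l + 1) := by
  rw [hact l (by simp; omega), eqTo_pk _ _ _ _ (hc l), pk_add]
  · apply pk_congr
    intro f _
    simp only [cnt]
    omega
  · intro f _
    unfold actF
    split_ifs <;> simp
  · intro f _
    exact reg_lt _ _ _ _

theorem cnt_land (m e L : ℕ) (c : ℕ → ℕ) (he : e ≤ 2)
    (hcnt : ∀ f ∈ fields, ∀ l ≤ L, cnt m c f l ≤ e + wtL (1 :: f))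
    (l : ℕ) (hl : l ≤ L) :
    Nat.land (pk fields fun f => startF e f + cnt m c f l) (pk fields (highF e)) = 0 := by
  have hb : ∀ f ∈ fields, startF e f + cnt m c f l ≤ 8 ∧
      (e + wtL (1 :: f) ≤ 7 → startF e f + cnt m c f l ≤ 7) := by
    intro f hf
    have h1 := hcnt f hf l hl
    have h2 := (fields_prop f hf).2.2
    unfold startF
    omega
  rw [pk_and, pk_congr fields _ (fun _ => 0), pk_zero]
  · intro f hf
    obtain ⟨h1, h2⟩ := hb f hf
    unfold highF
    split_ifs with h
    · have h3 := h2 h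
      generalize startF e f + cnt m c f l = x at *
      interval_cases x <;> rfl
    · simp
  · intro f hf
    have := (hb f hf).1
    omega
  · intro f _
    unfold highF
    split_ifs <;> omega

theorem search_sound (m e L : ℕ) (c : ℕ → ℕ) (hc : ∀ l, c l < 4) (he : e ≤ 2)
    (hact : ∀ l ∈ List.range' 0 L, actC m l = pk fields (actF m l))
    (hcnt : ∀ f ∈ fields, ∀ l ≤ L, cnt m c f l ≤ e + wtL (1 :: f))
    (leaf : List ℕ → Bool) (hleaf : leaf (path c L) = false) (n : ℕ) :
    ∀ l, l + n = L → search (pk fields (highF e)) leaf ((List.range' l n).map (actC m))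
      (pk fields fun f => startF e f + cnt m c f l) (pk fields fun f => reg c f 1 l)
      (pk fields fun f => reg c f 2 l) (pk fields fun f => reg c f 3 l)
      (pk fields fun f => reg c f 4 l) (pk fields fun f => reg c f 5 l) (path c l) = false := by
  induction n with
  | zero =>
    intro l hl
    have : l = L := by omega
    subst this
    exact hleaf
  | succ n ih =>
    intro l hl
    rw [List.range'_succ, List.map_cons]
    apply search_child _ _ _ _ _ _ _ _ _ _ _ (c l) (hc l)
    · rw [cnt_pack m e L c hc hact l (by omega)]
      exact cnt_land m e L c he hcnt (l + 1) (by omega)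
    · rw [cnt_pack m e L c hc hact l (by omega), reg_pack c hc l 1 (by simp),
        reg_pack c hc l 2 (by simp), reg_pack c hc l 3 (by simp), reg_pack c hc l 4 (by simp),
        reg_pack5 c hc l]
      exact ih (l + 1) (by omega)

theorem presearch_sound (m e L : ℕ) (c : ℕ → ℕ) (hc : ∀ l, c l < 4) (he : e ≤ 2)
    (hact : ∀ l ∈ List.range' 0 L, actC m l = pk fields (actF m l))
    (hcnt : ∀ f ∈ fields, ∀ l ≤ L, cnt m c f l ≤ e + wtL (1 :: f))
    (leaf : List ℕ → Bool) (hleaf : leaf (path c L) = false) (as : List ℕ) :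
    ∀ l n, l + n = L → (∀ i < as.length, as.getD i 0 = c (l + i)) →
      presearch (pk fields (highF e)) leaf as ((List.range' l n).map (actC m))
      (pk fields fun f => startF e f + cnt m c f l) (pk fields fun f => reg c f 1 l)
      (pk fields fun f => reg c f 2 l) (pk fields fun f => reg c f 3 l)
      (pk fields fun f => reg c f 4 l) (pk fields fun f => reg c f 5 l) (path c l) = false := by
  induction as with
  | nil =>
    intro l n hl _
    exact search_sound m e L c hc he hact hcnt leaf hleaf n l hl
  | cons a as ih =>
    intro l n hl has
    have ha : a = c l := by simpa using has 0 (by simp)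
    cases n with
    | zero =>
      have : l = L := by omega
      subst this
      exact hleaf
    | succ n =>
      rw [List.range'_succ, List.map_cons]
      subst ha
      have h0 := cnt_land m e L c he hcnt (l + 1) (by omega)
      have h1 := ih (l + 1) n (by omega) (fun i hi => by
        have := has (i + 1) (by simpa using hi)
        rw [List.getD_cons_succ] at this
        rw [this]
        congr 1
        omega)
      rw [← cnt_pack m e L c hc hact l (by omega), ← reg_pack c hc l 1 (by simp),
        ← reg_pack c hc l 2 (by simp), ← reg_pack c hc l 3 (by simp),
        ← reg_pack c hc l 4 (by simp), ← reg_pack5 c hc l] at h1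
      rw [← cnt_pack m e L c hc hact l (by omega)] at h0
      unfold presearch
      simp only [h0]
      exact h1

theorem run_sound (m e L : ℕ) (c : ℕ → ℕ) (hc : ∀ l, c l < 4) (he : e ≤ 2)
    (hact : ∀ l ∈ List.range' 0 L, actC m l = pk fields (actF m l))
    (hcnt : ∀ f ∈ fields, ∀ l ≤ L, cnt m c f l ≤ e + wtL (1 :: f))
    (ps : List (List ℕ)) (hleaf : leafC e ps (path c L) = false) (as : List ℕ)
    (has : ∀ i < as.length, as.getD i 0 = c i) : run m e L ps as = false := by
  have h := presearch_sound m e L c hc he hact hcnt (leafC e ps) hleaf as 0 L (by omega)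
    (by simpa using has)
  have hz : ∀ k, (pk fields fun f => reg c f k 0) = 0 := fun k => pk_zero fields
  rw [hz, hz, hz, hz, hz] at h
  exact h


/-! ## The field with four elements -/

section field
variable {F : Type*} [Field F]

/-- The field element with a given code. -/
def toF (ω : F) (a : ℕ) : F := if a = 0 then 0 else if a = 1 then 1 else if a = 2 then ω else ω + 1

/-- `ω` is a primitive element of a field with four elements. -/
structure Prim (ω : F) : Prop where
  two : (2 : F) = 0
  sq : ω ^ 2 = ω + 1
  surj : ∀ x : F, ∃ a < 4, toF ω a = x

theorem exists_prim [Fintype F] (hF : Fintype.card F = 4) : ∃ ω : F, Prim ω := by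
  classical
  have h4 : (4 : F) = 0 := by
    have := FiniteField.cast_card_eq_zero F
    rw [hF] at this
    exact_mod_cast this
  have h2 : (2 : F) = 0 := by
    have : (2 : F) * 2 = 0 := by linear_combination h4
    simpa using this
  have hx : ∀ x : F, x ^ 4 = x := fun x => by
    have := FiniteField.pow_card x
    rwa [hF] at this
  obtain ⟨ω, hω⟩ : ∃ ω : F, ω ∉ ({0, 1} : Finset F) := by
    by_contra! h
    have h1 : (Finset.univ : Finset F).card ≤ ({0, 1} : Finset F).card :=
      Finset.card_le_card fun x _ => h x
    have h3 := Finset.card_le_two (a := (0 : F)) (b := 1)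
    rw [Finset.card_univ, hF] at h1
    omega
  simp only [Finset.mem_insert, Finset.mem_singleton, not_or] at hω
  have hs : ω ^ 2 = ω + 1 := by
    have : ω * (ω - 1) * (ω ^ 2 + ω + 1) = 0 := by linear_combination hx ω
    rcases mul_eq_zero.1 this with h | h
    · exact absurd h (mul_ne_zero hω.1 (sub_ne_zero.2 hω.2))
    · linear_combination h - (ω + 1) * h2
  refine ⟨ω, h2, hs, fun x => ?_⟩
  have : x * (x - 1) * ((x - ω) * (x - (ω + 1))) = 0 := by
    have := hx x
    grind
  rcases mul_eq_zero.1 this with h | h <;> rcases mul_eq_zero.1 h with h | h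
  · exact ⟨0, by norm_num, by simp [toF, h]⟩
  · exact ⟨1, by norm_num, by simp [toF, sub_eq_zero.1 h]⟩
  · exact ⟨2, by norm_num, by simp [toF, sub_eq_zero.1 h]⟩
  · exact ⟨3, by norm_num, by simp [toF, sub_eq_zero.1 h]⟩

variable {ω : F}

theorem Prim.ne0 (h : Prim ω) : ω ≠ 0 := by
  rintro rfl
  have := h.sq
  norm_num at this

theorem Prim.ne1 (h : Prim ω) : ω + 1 ≠ 0 := by
  intro h1
  have := h.sq
  rw [h1] at this
  exact h.ne0 (by simpa using this)

theorem Prim.zero_iff (h : Prim ω) {a : ℕ} (ha : a < 4) : toF ω a = 0 ↔ a = 0 := by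
  have h0 := h.ne0
  have h1 := h.ne1
  interval_cases a <;> simp [toF, h0, h1]

theorem Prim.xor (h : Prim ω) {a b : ℕ} (ha : a < 4) (hb : b < 4) :
    toF ω (a ^^^ b) = toF ω a + toF ω b := by
  have h2 := h.two
  interval_cases a <;> interval_cases b <;> simp [toF] <;> grind

theorem Prim.mul (h : Prim ω) {a b : ℕ} (ha : a < 4) (hb : b < 4) :
    toF ω (mul4 a b) = toF ω a * toF ω b := by
  have h2 := h.two
  have hs := h.sq
  have t : mul4 a b = if a = 0 ∨ b = 0 then 0 else (a - 1 + (b - 1)) % 3 + 1 := by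
    cases a <;> cases b <;> simp [mul4]
  rw [t]
  interval_cases a <;> interval_cases b <;> simp [toF] <;> grind

theorem Prim.add_eq_zero (h : Prim ω) {x y : F} : x + y = 0 ↔ x = y := by
  have h2 := h.two
  constructor
  · intro H; linear_combination H - y * h2
  · rintro rfl; linear_combination x * h2

theorem Prim.inj (h : Prim ω) {a b : ℕ} (ha : a < 4) (hb : b < 4) (H : toF ω a = toF ω b) :
    a = b := by
  have h1 : toF ω (a ^^^ b) = 0 := by rw [h.xor ha hb]; exact h.add_eq_zero.2 H
  exact Nat.xor_eq_zero_iff.1 ((h.zero_iff (xor_lt4 ha hb)).1 h1)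

theorem Prim.pow4 (h : Prim ω) (x : F) : x ^ 4 = x := by
  obtain ⟨a, ha, rfl⟩ := h.surj x
  have h2 := h.two
  have hs := h.sq
  interval_cases a <;> simp [toF] <;> grind

theorem wtL_card (h : Prim ω) (g : List ℕ) (hg : ∀ a ∈ g, a < 4) [DecidableEq F] :
    wtL g = ((Finset.range g.length).filter fun i => toF ω (g.getD i 0) ≠ 0).card := by
  induction g with
  | nil => rfl
  | cons a g ih =>
    simp only [List.mem_cons, forall_eq_or_imp] at hg
    rw [wtL_cons, ih hg.2, Finset.card_filter, Finset.card_filter, List.length_cons,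
      Finset.sum_range_succ']
    simp only [List.getD_cons_succ, List.getD_cons_zero, ne_eq, h.zero_iff hg.1]
    rw [add_comm]
    by_cases ha : a = 0 <;> simp [ha]

theorem reg_toF (h : Prim ω) (c : ℕ → ℕ) (hc : ∀ l, c l < 4) (f : List ℕ) (hf : ∀ a ∈ f, a < 4)
    (l : ℕ) : ∀ k, toF ω (reg c f k l) =
      ∑ i ∈ Finset.range l, toF ω (coef f (k + i)) * toF ω (c (l - 1 - i)) := by
  have hco : ∀ k, coef f k < 4 := by
    intro k
    unfold coef
    by_cases hk : k < (1 :: f).length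
    · rw [List.getD_eq_getElem _ _ hk]
      have := List.getElem_mem hk
      rcases List.mem_cons.1 this with h1 | h1
      · omega
      · exact hf _ h1
    · rw [List.getD_eq_default _ _ (by omega)]
      norm_num
  induction l with
  | zero => intro k; simp [reg, toF]
  | succ l ih =>
    intro k
    simp only [reg]
    rw [h.xor (reg_lt _ _ _ _) (mul4_lt _ _), ih, h.mul (hco k) (hc l), Finset.sum_range_succ']
    congr 1
    apply Finset.sum_congr rfl
    intro i _
    rw [show k + 1 + i = k + (i + 1) by omega, show l + 1 - 1 - (i + 1) = l - 1 - i by omega]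

theorem dot_lt (p t : List ℕ) : dot p t < 4 := by
  induction p generalizing t with
  | nil => show 0 < 4; norm_num
  | cons a p ih =>
    cases t with
    | nil => show 0 < 4; norm_num
    | cons b t => exact xor_lt4 (mul4_lt a b) (ih t)

theorem dot_toF (h : Prim ω) (c : ℕ → ℕ) (hc : ∀ l, c l < 4) (p : List ℕ) :
    (∀ a ∈ p, a < 4) → ∀ l, p.length ≤ l → toF ω (dot p (path c l)) =
      ∑ i ∈ Finset.range p.length, toF ω (p.getD i 0) * toF ω (c (l - 1 - i)) := by
  induction p with
  | nil => intro _ l _; simp [dot, toF]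
  | cons a p ih =>
    intro hp l hl
    simp only [List.mem_cons, forall_eq_or_imp] at hp
    cases l with
    | zero => simp at hl
    | succ l =>
      have e : dot (a :: p) (path c (l + 1)) = mul4 a (c l) ^^^ dot p (path c l) := rfl
      rw [e, h.xor (mul4_lt _ _) (dot_lt _ _), h.mul hp.1 (hc l), ih hp.2 l (by simpa using hl),
        List.length_cons, Finset.sum_range_succ', add_comm]
      congr 1
      apply Finset.sum_congr rfl
      intro i _
      rw [List.getD_cons_succ, show l + 1 - 1 - (i + 1) = l - 1 - i by omega]

open Classical in
/-- The weight conditions on a stretch of length `L` of the diagonal word. -/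
def Valid (m e L : ℕ) (u : ℕ → F) : Prop :=
  ∀ b K, b < m → K ≤ m → b + K ≤ L → ∀ p : ℕ → F, (∃ i ≤ b, p i ≠ 0) →
    ((Finset.range K).filter fun j =>
      ∑ i ∈ Finset.range (b + 1), p i * u (b + j - i) = 0).card ≤
    e + ((Finset.range (b + 1)).filter fun i => p i ≠ 0).card

open Classical in
theorem valid_count (h : Prim ω) {m e L : ℕ} {u : ℕ → F} (hV : Valid m e L u) (g : List ℕ) (b : ℕ)
    (hlen : g.length = b + 1) (hg : ∀ a ∈ g, a < 4) (h0 : g.getD 0 0 ≠ 0) (hb : b < m) (l : ℕ)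
    (hl : l ≤ L) : ((Finset.range l).filter fun t => b ≤ t ∧ t < b + m ∧
      ∑ i ∈ Finset.range (b + 1), toF ω (g.getD i 0) * u (t - i) = 0).card ≤ e + wtL g := by
  rw [wtL_card h g hg, hlen]
  have hz : g.getD 0 0 < 4 := by
    rw [List.getD_eq_getElem _ _ (by omega)]
    exact hg _ (List.getElem_mem _)
  by_cases hbl : b ≤ l
  · refine le_trans ?_ (hV b (min (l - b) m) hb (by omega) (by omega)
      (fun i => toF ω (g.getD i 0)) ⟨0, by omega, fun H => h0 ((h.zero_iff hz).1 H)⟩)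
    apply Finset.card_le_card_of_injOn (fun t => t - b)
    · intro t ht
      simp only [Finset.coe_filter, Finset.mem_range, Set.mem_ofPred_eq] at ht ⊢
      obtain ⟨h1, h2, h3, h4⟩ := ht
      refine ⟨by omega, ?_⟩
      rw [show b + (t - b) = t by omega]
      exact h4
    · intro t ht t' ht' H
      simp only [Finset.coe_filter, Finset.mem_range, Set.mem_ofPred_eq] at ht ht' H
      omega
  · rw [Finset.filter_false_of_mem]
    · simp
    · intro t ht
      simp only [Finset.mem_range] at ht
      omega

theorem cnt_card (m : ℕ) (c : ℕ → ℕ) (f : List ℕ) (l : ℕ) :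
    cnt m c f l = ((Finset.range l).filter fun t => actF m t f = 1 ∧ reg c f 1 t = c t).card := by
  induction l with
  | zero => rfl
  | succ l ih =>
    rw [Finset.card_filter, Finset.sum_range_succ, ← Finset.card_filter, ← ih]
    rfl

theorem path_length (c : ℕ → ℕ) (l : ℕ) : (path c l).length = l := by
  induction l with
  | zero => rfl
  | succ l ih => simp [path, ih]

theorem zc_card (p : List ℕ) (c : ℕ → ℕ) (l : ℕ) : zc p (path c l) =
    ((Finset.range l).filter fun t => p.length ≤ t + 1 ∧ dot p (path c (t + 1)) = 0).card := by
  induction l with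
  | zero => rfl
  | succ l ih =>
    rw [Finset.card_filter, Finset.sum_range_succ, ← Finset.card_filter, ← ih]
    have e : zc p (path c (l + 1)) = (if p.length ≤ (path c l).length + 1 ∧
      dot p (c l :: path c l) = 0 then 1 else 0) + zc p (path c l) := rfl
    rw [e, path_length, add_comm]
    rfl

theorem no_start (h : Prim ω) {m e L : ℕ} {u : ℕ → F} (hV : Valid m e L u) (ps : List (List ℕ))
    (as : List ℕ) (hrun : run m e L ps as = true)
    (hact : ∀ l ∈ List.range' 0 L, actC m l = pk fields (actF m l)) (he : e ≤ 2) (hm : 6 < m)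
    (hL : L ≤ m + 6) (hps : ∀ p ∈ ps, p.length = 7 ∧ p.getD 0 0 ≠ 0 ∧ ∀ a ∈ p, a < 4)
    (has : ∀ a ∈ as, a < 4) (hu : ∀ i < as.length, toF ω (as.getD i 0) = u i) : False := by
  classical
  choose c hc hcu using fun k => h.surj (u k)
  have hcnt : ∀ f ∈ fields, ∀ l ≤ L, cnt m c f l ≤ e + wtL (1 :: f) := by
    intro f hf l hl
    obtain ⟨h5, hf4, -⟩ := fields_prop f hf
    refine le_trans ?_ (valid_count h hV (1 :: f) f.length (by simp)
      (by simpa using hf4) (by simp) (by omega) l hl)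
    rw [cnt_card]
    apply Finset.card_le_card
    intro t ht
    simp only [Finset.mem_filter, Finset.mem_range] at ht ⊢
    obtain ⟨h1, h2, h3⟩ := ht
    unfold actF at h2
    split_ifs at h2 with h4
    refine ⟨h1, h4.1, h4.2, ?_⟩
    have h6 := reg_toF h c hc f hf4 (t + 1) 0
    simp only [reg] at h6
    rw [h3, show mul4 (coef f 0) (c t) = c t from ?_, Nat.xor_self] at h6
    · simp only [hcu, zero_add, Nat.add_sub_cancel] at h6
      rw [show toF ω 0 = 0 by simp [toF]] at h6
      rw [h6]
      apply Finset.sum_subset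
      · intro i hi
        simp only [Finset.mem_range] at hi ⊢
        omega
      · intro i _ hi
        simp only [Finset.mem_range] at hi
        rw [List.getD_eq_default _ _ (by simp; omega)]
        simp [toF]
    · have := hc t
      show mul4 1 (c t) = c t
      generalize c t = x at *
      interval_cases x <;> rfl
  have hleaf : leafC e ps (path c L) = false := by
    unfold leafC
    rw [List.any_eq_false]
    intro p hp
    obtain ⟨h7, h0, h4⟩ := hps p hp
    rw [decide_eq_true_eq, not_lt]
    refine le_trans ?_ (valid_count h hV p 6 h7 h4 h0 hm L le_rfl)
    rw [zc_card]
    apply Finset.card_le_card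
    intro t ht
    simp only [Finset.mem_filter, Finset.mem_range] at ht ⊢
    obtain ⟨h1, h2, h3⟩ := ht
    refine ⟨h1, by omega, by omega, ?_⟩
    have h6 := dot_toF h c hc p h4 (t + 1) h2
    rw [h3, h7] at h6
    simp only [hcu, Nat.add_sub_cancel] at h6
    rw [show toF ω 0 = 0 by simp [toF]] at h6
    exact h6.symm
  have := run_sound m e L c hc he hact hcnt ps hleaf as (fun i hi => by
    apply h.inj (ω := ω) _ (hc i)
    · rw [hu i hi, hcu]
    · rw [List.getD_eq_getElem _ _ hi]
      exact has _ (List.getElem_mem _))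
  rw [this] at hrun
  exact absurd hrun (by simp)

end field

/-! ## Normalization of the diagonal word -/

section normalize
variable {F : Type*} [Field F] {ω : F}

theorem valid_scale {m e L : ℕ} {u : ℕ → F} (hV : Valid m e L u) {c q : F} (hc : c ≠ 0)
    (hq : q ≠ 0) : Valid m e L (fun k => c * q ^ k * u k) := by
  classical
  intro b K hb hK hL p hp
  have h := hV b K hb hK hL (fun i => p i * q⁻¹ ^ i) (by
    obtain ⟨i, hi, h0⟩ := hp
    exact ⟨i, hi, mul_ne_zero h0 (pow_ne_zero _ (inv_ne_zero hq))⟩)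
  have e1 : ∀ j, (∑ i ∈ Finset.range (b + 1), p i * (c * q ^ (b + j - i) * u (b + j - i))) =
      c * q ^ (b + j) * ∑ i ∈ Finset.range (b + 1), p i * q⁻¹ ^ i * u (b + j - i) := by
    intro j
    rw [Finset.mul_sum]
    apply Finset.sum_congr rfl
    intro i hi
    simp only [Finset.mem_range] at hi
    have : q ^ (b + j) = q ^ (b + j - i) * q ^ i := by
      rw [← pow_add]
      congr 1
      omega
    rw [this, inv_pow]
    field_simp
  have e2 : ∀ i, p i * q⁻¹ ^ i ≠ 0 ↔ p i ≠ 0 := by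
    intro i
    have := pow_ne_zero i (inv_ne_zero hq)
    simp only [ne_eq, mul_eq_zero, this, or_false]
  have e3 : ∀ j, c * q ^ (b + j) ≠ 0 := fun j => mul_ne_zero hc (pow_ne_zero _ hq)
  simp only [e2] at h
  simp only [e1, mul_eq_zero, mul_eq_zero.not.1 (e3 _), false_or]
  convert h using 3

theorem valid_frob (hω : Prim ω) {m e L : ℕ} {u : ℕ → F} (hV : Valid m e L u) :
    Valid m e L (fun k => u k ^ 2) := by
  classical
  have : CharP F 2 := CharTwo.of_one_ne_zero_of_two_eq_zero one_ne_zero hω.two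
  intro b K hb hK hL p hp
  have h := hV b K hb hK hL (fun i => p i ^ 2) (by
    obtain ⟨i, hi, h0⟩ := hp
    exact ⟨i, hi, pow_ne_zero _ h0⟩)
  have e1 : ∀ j, (∑ i ∈ Finset.range (b + 1), p i * u (b + j - i) ^ 2) =
      (∑ i ∈ Finset.range (b + 1), p i ^ 2 * u (b + j - i)) ^ 2 := by
    intro j
    rw [CharTwo.sum_sq]
    apply Finset.sum_congr rfl
    intro i _
    have := hω.pow4 (p i)
    calc p i * u (b + j - i) ^ 2 = p i ^ 4 * u (b + j - i) ^ 2 := by rw [this]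
      _ = _ := by ring
  have e2 : ∀ i, p i ^ 2 ≠ 0 ↔ p i ≠ 0 := fun i => by simp
  simp only [e2] at h
  simp only [e1, ne_eq, OfNat.ofNat_ne_zero, not_false_eq_true, pow_eq_zero_iff]
  exact h

/-- The word `u` starts with the codes `as`. -/
def Pre (ω : F) (as : List ℕ) (u : ℕ → F) : Prop := ∀ i < as.length, toF ω (as.getD i 0) = u i

theorem pre4 {a b c d : ℕ} {u : ℕ → F} (h0 : toF ω a = u 0) (h1 : toF ω b = u 1)
    (h2 : toF ω c = u 2) (h3 : toF ω d = u 3) : Pre ω [a, b, c, d] u := by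
  intro i hi
  simp only [List.length_cons, List.length_nil] at hi
  interval_cases i <;> simpa

theorem pre3 {a b c : ℕ} {u : ℕ → F} (h0 : toF ω a = u 0) (h1 : toF ω b = u 1)
    (h2 : toF ω c = u 2) : Pre ω [a, b, c] u := by
  intro i hi
  simp only [List.length_cons, List.length_nil] at hi
  interval_cases i <;> simpa

theorem pre6 {a b c a' b' c' : ℕ} {u : ℕ → F} (h0 : toF ω a = u 0) (h1 : toF ω b = u 1)
    (h2 : toF ω c = u 2) (h3 : toF ω a' = u 3) (h4 : toF ω b' = u 4) (h5 : toF ω c' = u 5) :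
    Pre ω [a, b, c, a', b', c'] u := by
  intro i hi
  simp only [List.length_cons, List.length_nil] at hi
  interval_cases i <;> simpa

theorem toF0 : toF ω 0 = 0 := by simp [toF]
theorem toF1 : toF ω 1 = 1 := by simp [toF]
theorem toF2 : toF ω 2 = ω := by simp [toF]
theorem toF3 : toF ω 3 = ω + 1 := by simp [toF]

theorem Prim.sq3 (h : Prim ω) : (ω + 1) ^ 2 = ω := by
  have h2 := h.two
  have hs := h.sq
  grind

theorem Prim.cube (h : Prim ω) {x : F} (hx : x ≠ 0) : x ^ 3 = 1 := by
  have := h.pow4 x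
  have h1 : x * (x ^ 3 - 1) = 0 := by linear_combination this
  rcases mul_eq_zero.1 h1 with h2 | h2
  · exact absurd h2 hx
  · linear_combination h2

variable {P : (ℕ → F) → Prop}

theorem case_zero (hω : Prim ω)
    (hs : ∀ u (c q : F), c ≠ 0 → q ≠ 0 → P u → P (fun k => c * q ^ k * u k))
    (hf : ∀ u, P u → P (fun k => u k ^ 2))
    (hno : ∀ as ∈ [[0, 0, 0, 0], [0, 0, 0, 1], [0, 0, 1, 0], [0, 0, 1, 1], [0, 1, 0, 0],
      [0, 1, 0, 1], [0, 1, 1, 0], [0, 1, 1, 1], [0, 1, 1, 2]], ∀ u, P u → ¬ Pre ω as u)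
    (u : ℕ → F) (hu : P u) : u 0 ≠ 0 := by
  intro h0
  by_cases h1 : u 1 = 0
  · by_cases h2 : u 2 = 0
    · by_cases h3 : u 3 = 0
      · exact hno [0, 0, 0, 0] (by simp) u hu (pre4 (by simp [toF0, h0]) (by simp [toF0, h1])
          (by simp [toF0, h2]) (by simp [toF0, h3]))
      · exact hno [0, 0, 0, 1] (by simp) _ (hs u (u 3)⁻¹ 1 (inv_ne_zero h3) one_ne_zero hu)
          (pre4 (by simp [toF0, h0]) (by simp [toF0, h1]) (by simp [toF0, h2])
          (by simp [toF1, h3]))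
    · by_cases h3 : u 3 = 0
      · exact hno [0, 0, 1, 0] (by simp) _ (hs u (u 2)⁻¹ 1 (inv_ne_zero h2) one_ne_zero hu)
          (pre4 (by simp [toF0, h0]) (by simp [toF0, h1]) (by simp [toF1, h2])
          (by simp [toF0, h3]))
      · have hq : u 2 / u 3 ≠ 0 := div_ne_zero h2 h3
        exact hno [0, 0, 1, 1] (by simp) _ (hs u ((u 2 / u 3) ^ 2 * u 2)⁻¹ (u 2 / u 3)
          (inv_ne_zero (mul_ne_zero (pow_ne_zero _ hq) h2)) hq hu)
          (pre4 (by simp [toF0, h0]) (by simp [toF0, h1]) (by rw [toF1]; field_simp)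
          (by rw [toF1]; field_simp))
  · by_cases h2 : u 2 = 0
    · by_cases h3 : u 3 = 0
      · exact hno [0, 1, 0, 0] (by simp) _ (hs u (u 1)⁻¹ 1 (inv_ne_zero h1) one_ne_zero hu)
          (pre4 (by simp [toF0, h0]) (by simp [toF1, h1]) (by simp [toF0, h2])
          (by simp [toF0, h3]))
      · have hq : u 3 / u 1 ≠ 0 := div_ne_zero h3 h1
        exact hno [0, 1, 0, 1] (by simp) _ (hs u (u 3)⁻¹ (u 3 / u 1) (inv_ne_zero h3) hq hu)
          (pre4 (by simp [toF0, h0]) (by rw [toF1]; field_simp) (by simp [toF0, h2])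
          (by rw [toF1, hω.cube hq]; field_simp))
    · have hq : u 1 / u 2 ≠ 0 := div_ne_zero h1 h2
      have hv := hs u ((u 1 / u 2) * u 1)⁻¹ (u 1 / u 2) (inv_ne_zero (mul_ne_zero hq h1)) hq hu
      set v : ℕ → F := fun k => ((u 1 / u 2) * u 1)⁻¹ * (u 1 / u 2) ^ k * u k with hvdef
      have v0 : v 0 = 0 := by simp [hvdef, h0]
      have v1 : v 1 = 1 := by simp only [hvdef]; field_simp
      have v2 : v 2 = 1 := by simp only [hvdef]; field_simp
      obtain ⟨a, ha, hva⟩ := hω.surj (v 3)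
      interval_cases a
      · exact hno [0, 1, 1, 0] (by simp) v hv (pre4 (by simp [toF0, v0]) (by simp [toF1, v1])
          (by simp [toF1, v2]) hva)
      · exact hno [0, 1, 1, 1] (by simp) v hv (pre4 (by simp [toF0, v0]) (by simp [toF1, v1])
          (by simp [toF1, v2]) hva)
      · exact hno [0, 1, 1, 2] (by simp) v hv (pre4 (by simp [toF0, v0]) (by simp [toF1, v1])
          (by simp [toF1, v2]) hva)
      · exact hno [0, 1, 1, 2] (by simp) _ (hf v hv) (pre4 (by simp [toF0, v0])
          (by simp [toF1, v1]) (by simp [toF1, v2]) (by rw [← hva, toF3, toF2, hω.sq3]))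

theorem normalize_two (hs : ∀ u (c q : F), c ≠ 0 → q ≠ 0 → P u → P (fun k => c * q ^ k * u k))
    (u : ℕ → F) (hu : P u) (h0 : u 0 ≠ 0) (h1 : u 1 ≠ 0) :
    ∃ c q : F, c ≠ 0 ∧ q ≠ 0 ∧ c * q ^ 0 * u 0 = 1 ∧ c * q ^ 1 * u 1 = 1 ∧
      P (fun k => c * q ^ k * u k) := by
  have hq : u 0 / u 1 ≠ 0 := div_ne_zero h0 h1
  refine ⟨(u 0)⁻¹, u 0 / u 1, inv_ne_zero h0, hq, by field_simp, by field_simp,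
    hs u _ _ (inv_ne_zero h0) hq hu⟩

theorem case8 (hω : Prim ω)
    (hs : ∀ u (c q : F), c ≠ 0 → q ≠ 0 → P u → P (fun k => c * q ^ k * u k))
    (hf : ∀ u, P u → P (fun k => u k ^ 2))
    (hno : ∀ as ∈ [[1, 1, 1], [1, 1, 2]], ∀ u, P u → ¬ Pre ω as u)
    (u : ℕ → F) (hu : P u) (h0 : u 0 ≠ 0) (h1 : u 1 ≠ 0) (h2 : u 2 ≠ 0) : False := by
  obtain ⟨c, q, hc, hq, v0, v1, hv⟩ := normalize_two hs u hu h0 h1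
  obtain ⟨a, ha, hva⟩ := hω.surj (c * q ^ 2 * u 2)
  interval_cases a
  · rw [toF0] at hva
    exact mul_ne_zero (mul_ne_zero hc (pow_ne_zero _ hq)) h2 hva.symm
  · exact hno [1, 1, 1] (by simp) _ hv (pre3 (by rw [toF1, v0]) (by rw [toF1, v1]) hva)
  · exact hno [1, 1, 2] (by simp) _ hv (pre3 (by rw [toF1, v0]) (by rw [toF1, v1]) hva)
  · exact hno [1, 1, 2] (by simp) _ (hf _ hv) (pre3 (by rw [toF1, v0, one_pow])
      (by rw [toF1, v1, one_pow]) (by rw [← hva, toF3, toF2, hω.sq3]))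

theorem case_geom (hω : Prim ω)
    (hs : ∀ u (c q : F), c ≠ 0 → q ≠ 0 → P u → P (fun k => c * q ^ k * u k))
    (hf : ∀ u, P u → P (fun k => u k ^ 2))
    (hno : ∀ as ∈ [[1, 1, 1, 0], [1, 1, 1, 1], [1, 1, 1, 2]], ∀ u, P u → ¬ Pre ω as u)
    (u : ℕ → F) (hu : P u) (h0 : u 0 ≠ 0) (h1 : u 1 ≠ 0) : u 0 * u 2 ≠ u 1 ^ 2 := by
  intro hg
  obtain ⟨c, q, hc, hq, v0, v1, hv⟩ := normalize_two hs u hu h0 h1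
  have v2 : c * q ^ 2 * u 2 = 1 := by
    have : (c * q ^ 0 * u 0) * (c * q ^ 2 * u 2) = (c * q ^ 1 * u 1) ^ 2 := by
      linear_combination c ^ 2 * q ^ 2 * hg
    rw [v0, v1] at this
    linear_combination this
  obtain ⟨a, ha, hva⟩ := hω.surj (c * q ^ 3 * u 3)
  interval_cases a
  · exact hno [1, 1, 1, 0] (by simp) _ hv (pre4 (by rw [toF1, v0]) (by rw [toF1, v1])
      (by rw [toF1, v2]) hva)
  · exact hno [1, 1, 1, 1] (by simp) _ hv (pre4 (by rw [toF1, v0]) (by rw [toF1, v1])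
      (by rw [toF1, v2]) hva)
  · exact hno [1, 1, 1, 2] (by simp) _ hv (pre4 (by rw [toF1, v0]) (by rw [toF1, v1])
      (by rw [toF1, v2]) hva)
  · exact hno [1, 1, 1, 2] (by simp) _ (hf _ hv) (pre4 (by rw [toF1, v0, one_pow])
      (by rw [toF1, v1, one_pow]) (by rw [toF1, v2, one_pow])
      (by rw [← hva, toF3, toF2, hω.sq3]))

/-- The prefixes needed in the generic case for `m = 11`. -/
def gen11 : List (List ℕ) := [[1, 1, 2, 1, 1, 2], [1, 1, 2, 2, 3, 2], [1, 1, 2, 1, 2, 1],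
    [1, 1, 2, 2, 1, 1], [1, 1, 2, 1, 1, 3], [1, 1, 2, 2, 3, 3], [1, 1, 2, 1, 2, 2],
    [1, 1, 2, 2, 1, 2]]

theorem gen11_mem : ∀ a ∈ [0, 1, 2, 3], ∀ b ∈ [0, 1, 2, 3], ∀ c ∈ [0, 1, 2, 3],
    a ≠ 0 → b ≠ 0 → c ≠ 0 → mul4 1 a ≠ mul4 2 2 → mul4 2 b ≠ mul4 a a → mul4 a c ≠ mul4 b b →
      [1, 1, 2, a, b, c] ∈ gen11 := by
  decide

theorem case_gen (hω : Prim ω) (hno : ∀ as ∈ gen11, ∀ u, P u → ¬ Pre ω as u)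
    (u : ℕ → F) (hu : P u) (h0 : u 0 = 1) (h1 : u 1 = 1) (h2 : u 2 = ω)
    (h3 : u 3 ≠ 0) (h4 : u 4 ≠ 0) (h5 : u 5 ≠ 0)
    (g1 : u 1 * u 3 ≠ u 2 ^ 2) (g2 : u 2 * u 4 ≠ u 3 ^ 2) (g3 : u 3 * u 5 ≠ u 4 ^ 2) : False := by
  obtain ⟨a, ha, ea⟩ := hω.surj (u 3)
  obtain ⟨b, hb, eb⟩ := hω.surj (u 4)
  obtain ⟨c, hc, ec⟩ := hω.surj (u 5)
  have l1 : (1 : ℕ) < 4 := by norm_num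
  have l2 : (2 : ℕ) < 4 := by norm_num
  refine hno [1, 1, 2, a, b, c] (gen11_mem a (by simp; omega) b (by simp; omega) c
    (by simp; omega) ?_ ?_ ?_ ?_ ?_ ?_) u hu (pre6 (by rw [toF1, h0]) (by rw [toF1, h1])
    (by rw [toF2, h2]) ea eb ec)
  · rintro rfl; exact h3 (by rw [← ea, toF0])
  · rintro rfl; exact h4 (by rw [← eb, toF0])
  · rintro rfl; exact h5 (by rw [← ec, toF0])
  · intro H
    have := congrArg (toF ω) H
    rw [hω.mul l1 ha, hω.mul l2 l2, toF1, toF2, ea] at this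
    exact g1 (by rw [h1, h2, this, sq])
  · intro H
    have := congrArg (toF ω) H
    rw [hω.mul l2 hb, hω.mul ha ha, toF2, ea, eb] at this
    exact g2 (by rw [h2, this, sq])
  · intro H
    have := congrArg (toF ω) H
    rw [hω.mul ha hc, hω.mul hb hb, ea, eb, ec] at this
    exact g3 (by rw [this, sq])

theorem case11 (hω : Prim ω)
    (hs : ∀ u (c q : F), c ≠ 0 → q ≠ 0 → P u → P (fun k => c * q ^ k * u k))
    (hf : ∀ u, P u → P (fun k => u k ^ 2))
    (hno : ∀ as ∈ gen11, ∀ u, P u → ¬ Pre ω as u)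
    (u : ℕ → F) (hu : P u) (hu0 : ∀ i < 6, u i ≠ 0)
    (hg : ∀ i < 4, u i * u (i + 2) ≠ u (i + 1) ^ 2) : False := by
  obtain ⟨c, q, hc, hq, v0, v1, hv⟩ := normalize_two hs u hu (hu0 0 (by norm_num))
    (hu0 1 (by norm_num))
  have hv0 : ∀ i < 6, c * q ^ i * u i ≠ 0 := fun i hi =>
    mul_ne_zero (mul_ne_zero hc (pow_ne_zero _ hq)) (hu0 i hi)
  have hvg : ∀ i < 4, (c * q ^ i * u i) * (c * q ^ (i + 2) * u (i + 2)) ≠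
      (c * q ^ (i + 1) * u (i + 1)) ^ 2 := by
    intro i hi H
    have h1 : (c * q ^ (i + 1)) ^ 2 * (u i * u (i + 2) - u (i + 1) ^ 2) = 0 := by
      linear_combination H
    rcases mul_eq_zero.1 h1 with h2 | h2
    · exact pow_ne_zero 2 (mul_ne_zero hc (pow_ne_zero _ hq)) h2
    · exact hg i hi (sub_eq_zero.1 h2)
  generalize hvdef : (fun k => c * q ^ k * u k) = v at hv
  have hvk : ∀ k, c * q ^ k * u k = v k := fun k => by rw [← hvdef]
  simp only [hvk] at v0 v1 hv0 hvg
  obtain ⟨a, ha, hva⟩ := hω.surj (v 2)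
  interval_cases a
  · exact hv0 2 (by norm_num) (by rw [← hva, toF0])
  · exact hvg 0 (by norm_num) (by simp only [zero_add]; rw [← hva, toF1, v0, v1]; ring)
  · rw [toF2] at hva
    exact case_gen hω hno v hv v0 v1 hva.symm (hv0 3 (by norm_num)) (hv0 4 (by norm_num))
      (hv0 5 (by norm_num)) (hvg 1 (by norm_num)) (hvg 2 (by norm_num)) (hvg 3 (by norm_num))
  · rw [toF3] at hva
    have hsq : ∀ x y : F, x ^ 2 = y ^ 2 → x = y := by
      intro x y H
      calc x = (x ^ 2) ^ 2 := by rw [← pow_mul]; exact (hω.pow4 x).symm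
        _ = (y ^ 2) ^ 2 := by rw [H]
        _ = y := by rw [← pow_mul]; exact hω.pow4 y
    have hvg2 : ∀ i < 4, v i ^ 2 * v (i + 2) ^ 2 ≠ (v (i + 1) ^ 2) ^ 2 := by
      intro i hi H
      exact hvg i hi (hsq _ _ (by rw [mul_pow, H]))
    exact case_gen hω hno _ (hf v hv) (by simp [v0]) (by simp [v1])
      (by show v 2 ^ 2 = ω; rw [← hva, hω.sq3])
      (pow_ne_zero _ (hv0 3 (by norm_num))) (pow_ne_zero _ (hv0 4 (by norm_num)))
      (pow_ne_zero _ (hv0 5 (by norm_num))) (hvg2 1 (by norm_num)) (hvg2 2 (by norm_num))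
      (hvg2 3 (by norm_num))

/-- There is no valid diagonal word for `m = 8`. -/
theorem no_word8 (hω : Prim ω) (s : ℕ → F)
    (hV : ∀ i, i + 13 ≤ 15 → Valid 8 1 13 (fun k => s (i + k))) : False := by
  have hs : ∀ u (c q : F), c ≠ 0 → q ≠ 0 → Valid 8 1 13 u →
      Valid 8 1 13 (fun k => c * q ^ k * u k) := fun u c q hc hq hu => valid_scale hu hc hq
  have hf : ∀ u : ℕ → F, Valid 8 1 13 u → Valid 8 1 13 (fun k => u k ^ 2) :=
    fun u hu => valid_frob hω hu
  have hno : ∀ as, run 8 1 13 ps8 as = true → (∀ a ∈ as, a < 4) → ∀ u : ℕ → F,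
      Valid 8 1 13 u → ¬ Pre ω as u := fun as h1 h2 u hu hp =>
    no_start hω hu ps8 as h1 act_eq8 (by norm_num) (by norm_num) (by norm_num) (by decide) h2 hp
  have hz := case_zero hω hs hf (fun as has => hno as
    (run8 as (by revert as; decide)) (by revert as; decide))
  exact case8 hω hs hf (fun as has => hno as
    (run8 as (by revert as; decide)) (by revert as; decide)) (fun k => s (0 + k))
    (hV 0 (by norm_num)) (by simpa using hz _ (hV 0 (by norm_num)))
    (by simpa using hz _ (hV 1 (by norm_num))) (by simpa using hz _ (hV 2 (by norm_num)))

theorem run11_zero : ∀ as ∈ [[0, 0, 0, 0], [0, 0, 0, 1], [0, 0, 1, 0], [0, 0, 1, 1], [0, 1, 0, 0],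
      [0, 1, 0, 1], [0, 1, 1, 0], [0, 1, 1, 1], [0, 1, 1, 2]], run 11 2 16 ps11 as = true := by
  intro as has
  have h : as ∈ [[0, 0, 0, 0], [0, 0, 0, 1], [0, 0, 1, 0], [0, 0, 1, 1], [0, 1, 0, 0]] ∨
      as = [0, 1, 0, 1] ∨ as = [0, 1, 1, 0] ∨ as = [0, 1, 1, 1] ∨ as = [0, 1, 1, 2] := by
    revert as; decide
  rcases h with h | rfl | rfl | rfl | rfl
  · exact run11_a as h
  · exact run11_b
  · exact run11_c
  · exact run11_d
  · exact run11_e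

theorem run11_geom : ∀ as ∈ [[1, 1, 1, 0], [1, 1, 1, 1], [1, 1, 1, 2]],
    run 11 2 16 ps11 as = true := by
  intro as has
  simp only [List.mem_cons, List.not_mem_nil, or_false] at has
  rcases has with rfl | rfl | rfl
  · exact run11_f
  · exact run11_g
  · exact run11_h

/-- There is no valid diagonal word for `m = 11`. -/
theorem no_word11 (hω : Prim ω) (s : ℕ → F)
    (hV : ∀ i, i + 16 ≤ 21 → Valid 11 2 16 (fun k => s (i + k))) : False := by
  have hs : ∀ u (c q : F), c ≠ 0 → q ≠ 0 → Valid 11 2 16 u →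
      Valid 11 2 16 (fun k => c * q ^ k * u k) := fun u c q hc hq hu => valid_scale hu hc hq
  have hf : ∀ u : ℕ → F, Valid 11 2 16 u → Valid 11 2 16 (fun k => u k ^ 2) :=
    fun u hu => valid_frob hω hu
  have hno : ∀ as, run 11 2 16 ps11 as = true → (∀ a ∈ as, a < 4) → ∀ u : ℕ → F,
      Valid 11 2 16 u → ¬ Pre ω as u := fun as h1 h2 u hu hp =>
    no_start hω hu ps11 as h1 act_eq11 (by norm_num) (by norm_num) (by norm_num) (by decide) h2 hp
  have hz := case_zero hω hs hf (fun as has => hno as (run11_zero as has) (by revert as; decide))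
  have hz' : ∀ i < 6, s i ≠ 0 := fun i hi => hz _ (hV i (by omega))
  have hg := case_geom hω hs hf (fun as has => hno as (run11_geom as has) (by revert as; decide))
  refine case11 hω hs hf (fun as has => hno as (run11_i as has) (by revert as; decide))
    (fun k => s (0 + k)) (hV 0 (by norm_num)) (fun i hi => by simpa using hz' i hi)
    (fun i hi => ?_)
  simp only [zero_add]
  exact hg _ (hV i (by omega)) (hz' _ (by omega)) (hz' _ (by omega))

end normalize

/-! ## Weights of codewords -/

section weights
variable {F : Type*} [Field F]

open Classical in
theorem wt_eq {ι : Type*} [Fintype ι] (v : ι → F) :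
    wt v = (Finset.univ.filter fun i => v i ≠ 0).card := by
  unfold wt
  rw [Nat.card_eq_fintype_card, Fintype.card_subtype]

theorem wt_elim {m n : ℕ} (x : Fin m → F) (y : Fin n → F) : wt (Sum.elim x y) = wt x + wt y := by
  classical
  rw [wt_eq, wt_eq, wt_eq, Finset.card_filter, Finset.card_filter, Finset.card_filter,
    Fintype.sum_sum_type]
  simp only [Sum.elim_inl, Sum.elim_inr]
  congr

theorem elim_ne {m : ℕ} {x : Fin m → F} {A : Matrix (Fin m) (Fin m) F} (hx : x ≠ 0) :
    Sum.elim x (Matrix.vecMul x A) ≠ 0 := by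
  intro H
  apply hx
  funext i
  exact congrFun H (Sum.inl i)

/-- Every double Toeplitz code has a nonzero codeword of weight at most `d`. -/
def Up (F : Type*) [Field F] (m d : ℕ) : Prop :=
  ∀ A : Matrix (Fin m) (Fin m) F, IsToeplitz A →
    ∃ x : Fin m → F, x ≠ 0 ∧ wt x + wt (Matrix.vecMul x A) ≤ d

/-- Some double Toeplitz code has minimum weight at least `d`. -/
def Lo (F : Type*) [Field F] (m d : ℕ) : Prop :=
  ∃ A : Matrix (Fin m) (Fin m) F, IsToeplitz A ∧
    ∀ x : Fin m → F, x ≠ 0 → d ≤ wt x + wt (Matrix.vecMul x A)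

theorem largest_of {m d : ℕ} (hU : Up F m d) (hL : Lo F m d) : DTlargestEq F m d := by
  refine ⟨?_, ?_⟩
  · obtain ⟨A, hA, hd⟩ := hL
    refine ⟨A, hA, ?_, ?_⟩
    · obtain ⟨x, hx, hw⟩ := hU A hA
      refine ⟨_, ⟨x, rfl⟩, elim_ne hx, ?_⟩
      rw [wt_elim]
      exact le_antisymm hw (hd x hx)
    · rintro w ⟨c, ⟨x, rfl⟩, hc, rfl⟩
      rw [wt_elim]
      apply hd
      rintro rfl
      apply hc
      rw [Matrix.zero_vecMul]
      funext i
      cases i <;> rfl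
  · intro A hA
    obtain ⟨x, hx, hw⟩ := hU A hA
    exact ⟨_, ⟨x, rfl⟩, elim_ne hx, by rw [wt_elim]; exact hw⟩

/-- Deleting the last row and column. -/
def cut {m : ℕ} (A : Matrix (Fin (m + 1)) (Fin (m + 1)) F) : Matrix (Fin m) (Fin m) F :=
  A.submatrix Fin.castSucc Fin.castSucc

theorem cut_toeplitz {m : ℕ} {A : Matrix (Fin (m + 1)) (Fin (m + 1)) F} (hA : IsToeplitz A) :
    IsToeplitz (cut A) := fun i j i' j' h => hA _ _ _ _ (by simpa using h)

theorem wt_snoc {m : ℕ} (v : Fin (m + 1) → F) :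
    wt v ≤ wt (fun i : Fin m => v i.castSucc) + 1 ∧
      (v (Fin.last m) = 0 → wt v = wt (fun i : Fin m => v i.castSucc)) := by
  classical
  rw [wt_eq, wt_eq, Finset.card_filter, Finset.card_filter, Fin.sum_univ_castSucc]
  constructor
  · split_ifs <;> simp
  · intro h; simp [h]

theorem cut_word {m : ℕ} (A : Matrix (Fin (m + 1)) (Fin (m + 1)) F) (x : Fin m → F) (hx : x ≠ 0) :
    ∃ x' : Fin (m + 1) → F, x' ≠ 0 ∧ wt x' + wt (Matrix.vecMul x' A) ≤
      wt x + wt (Matrix.vecMul x (cut A)) + 1 := by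
  refine ⟨Fin.snoc x 0, ?_, ?_⟩
  · intro H
    apply hx
    funext i
    have := congrFun H i.castSucc
    simpa using this
  · have h1 : wt (Fin.snoc (α := fun _ => F) x 0) = wt x := by
      rw [(wt_snoc (Fin.snoc (α := fun _ => F) x 0)).2 (by simp)]
      simp only [Fin.snoc_castSucc]
    have h2 := (wt_snoc (Matrix.vecMul (Fin.snoc (α := fun _ => F) x 0) A)).1
    have e : (fun i : Fin m => Matrix.vecMul (Fin.snoc (α := fun _ => F) x 0) A i.castSucc) =
        Matrix.vecMul x (cut A) := by
      funext j
      simp [Matrix.vecMul, dotProduct, Fin.sum_univ_castSucc, cut]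
    rw [e] at h2
    rw [h1]
    omega

theorem Up.succ {m d : ℕ} (h : Up F m d) : Up F (m + 1) (d + 1) := by
  intro A hA
  obtain ⟨x, hx, hw⟩ := h (cut A) (cut_toeplitz hA)
  obtain ⟨x', hx', hw'⟩ := cut_word A x hx
  exact ⟨x', hx', by omega⟩

theorem Lo.pred {m d : ℕ} (h : Lo F (m + 1) (d + 1)) : Lo F m d := by
  obtain ⟨A, hA, hd⟩ := h
  refine ⟨cut A, cut_toeplitz hA, fun x hx => ?_⟩
  obtain ⟨x', hx', hw'⟩ := cut_word A x hx
  have := hd x' hx'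
  omega

theorem toeplitz_word {m : ℕ} {A : Matrix (Fin m) (Fin m) F} (hA : IsToeplitz A) (hm : 0 < m) :
    ∃ s : ℕ → F, ∀ i j : Fin m, A i j = s (m - 1 - i + j) := by
  refine ⟨fun k => if h : k ≤ m - 1 then A ⟨m - 1 - k, by omega⟩ ⟨0, hm⟩ else
    if h' : k - (m - 1) < m then A ⟨0, hm⟩ ⟨k - (m - 1), h'⟩ else 0, fun i j => ?_⟩
  have hi := i.2
  have hj := j.2
  simp only
  split_ifs with h1 h2
  · apply hA
    simp only
    omega
  · apply hA
    simp only
    omega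
  · omega

theorem valid_of_word {m d e : ℕ} {A : Matrix (Fin m) (Fin m) F} (s : ℕ → F)
    (hs : ∀ i j : Fin m, A i j = s (m - 1 - i + j)) (hd : m ≤ d + e)
    (hx : ∀ x : Fin m → F, x ≠ 0 → d ≤ wt x + wt (Matrix.vecMul x A))
    (i₀ L : ℕ) (hL : i₀ + L ≤ 2 * m - 1) : Valid m e L (fun k => s (i₀ + k)) := by
  classical
  intro b K hb hK hbK p hp
  obtain ⟨sh, off, h1, h2, h3⟩ : ∃ sh off, sh + b ≤ m - 1 ∧ off + K ≤ m ∧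
      m - 1 + off = sh + i₀ + b := by
    by_cases h : i₀ + b ≤ m - 1
    · exact ⟨m - 1 - i₀ - b, 0, by omega, by omega, by omega⟩
    · exact ⟨0, i₀ + b - (m - 1), by omega, by omega, by omega⟩
  let X : ℕ → F := fun i => if sh ≤ i ∧ i ≤ sh + b then p (i - sh) else 0
  let x : Fin m → F := fun i => X i
  have hx0 : x ≠ 0 := by
    obtain ⟨i, hi, hpi⟩ := hp
    intro H
    have := congrFun H ⟨sh + i, by omega⟩
    simp only [x, X, Pi.zero_apply] at this
    rw [if_pos ⟨by omega, by omega⟩, show sh + i - sh = i by omega] at this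
    exact hpi this
  have hw := hx x hx0
  have hwx : wt x ≤ ((Finset.range (b + 1)).filter fun i => p i ≠ 0).card := by
    rw [wt_eq]
    apply Finset.card_le_card_of_injOn (fun i : Fin m => (i : ℕ) - sh)
    · intro i hi
      simp only [Finset.coe_filter, Finset.mem_univ, true_and, Set.mem_ofPred_eq, x, X] at hi
      simp only [Finset.coe_filter, Finset.mem_range, Set.mem_ofPred_eq]
      split_ifs at hi with h
      · exact ⟨by omega, hi⟩
      · exact absurd rfl hi
    · intro i hi i' hi' H
      simp only [Finset.coe_filter, Finset.mem_univ, true_and, Set.mem_ofPred_eq, x, X] at hi hi' H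
      split_ifs at hi hi' with h h'
      · exact Fin.ext (by omega)
      all_goals simp at *
  have hy : ∀ j : Fin m, Matrix.vecMul x A j =
      ∑ i ∈ Finset.range (b + 1), p i * s (m - 1 - (sh + i) + j) := by
    intro j
    have e1 : Matrix.vecMul x A j = ∑ i : Fin m, X i * s (m - 1 - i + j) := by
      simp only [Matrix.vecMul, dotProduct, hs, x]
    rw [e1, Fin.sum_univ_eq_sum_range (fun i => X i * s (m - 1 - i + j)) m]
    symm
    apply Finset.sum_of_injOn (fun i => sh + i)
    · intro i _ i' _ H
      simp only at H
      omega
    · intro i hi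
      simp only [Finset.coe_range, Set.mem_Iio] at hi ⊢
      omega
    · intro i _ hi
      simp only [Finset.coe_range, Set.mem_image, Set.mem_Iio, not_exists, not_and] at hi
      have : X i = 0 := by
        simp only [X]
        rw [if_neg]
        intro h
        exact hi (i - sh) (by omega) (by omega)
      rw [this, zero_mul]
    · intro i hi
      simp only [Finset.mem_range] at hi
      simp only [X]
      rw [if_pos ⟨by omega, by omega⟩, show sh + i - sh = i by omega]
  have hwy : wt (Matrix.vecMul x A) + ((Finset.range K).filter fun j =>
      ∑ i ∈ Finset.range (b + 1), p i * s (i₀ + (b + j - i)) = 0).card ≤ m := by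
    have hc := Finset.card_filter_add_card_filter_not (s := (Finset.univ : Finset (Fin m)))
      (fun j => Matrix.vecMul x A j ≠ 0)
    rw [← wt_eq, Finset.card_univ, Fintype.card_fin] at hc
    have : ((Finset.range K).filter fun j =>
      ∑ i ∈ Finset.range (b + 1), p i * s (i₀ + (b + j - i)) = 0).card ≤
        (Finset.univ.filter fun j : Fin m => ¬ Matrix.vecMul x A j ≠ 0).card := by
      apply Finset.card_le_card_of_surjOn (fun j : Fin m => (j : ℕ) - off)
      intro j hj
      simp only [Finset.coe_filter, Finset.mem_range, Set.mem_ofPred_eq] at hj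
      refine ⟨⟨j + off, by omega⟩, ?_, by simp⟩
      simp only [Finset.coe_filter, Finset.mem_univ, true_and, Set.mem_ofPred_eq, not_not]
      rw [hy, ← hj.2]
      apply Finset.sum_congr rfl
      intro i hi
      simp only [Finset.mem_range] at hi
      congr 2
      simp only
      omega
    omega
  beta_reduce
  omega

theorem up8 {ω : F} (hω : Prim ω) : Up F 8 6 := by
  intro A hA
  by_contra! H
  obtain ⟨s, hs⟩ := toeplitz_word hA (by norm_num)
  exact no_word8 hω s fun i hi => valid_of_word (d := 7) s hs (by norm_num)
    (fun x hx => H x hx) i 13 (by omega)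

theorem up11 {ω : F} (hω : Prim ω) : Up F 11 8 := by
  intro A hA
  by_contra! H
  obtain ⟨s, hs⟩ := toeplitz_word hA (by norm_num)
  exact no_word11 hω s fun i hi => valid_of_word (d := 9) s hs (by norm_num)
    (fun x hx => H x hx) i 16 (by omega)

end weights

/-! ## Lower bounds: checking circulant matrices -/

/-- Entries of the circulant matrix with first row `t`. -/
def circ (t : List ℕ) (m i j : ℕ) : ℕ := t.getD ((j + m - i) % m) 0

/-- The combination of the first `r` rows of `M` with coefficients `x`. -/
def out (M : ℕ → ℕ → ℕ) (x : ℕ → ℕ) : ℕ → ℕ → ℕ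
  | 0, _ => 0
  | r + 1, j => out M x r j ^^^ mul4 (x r) (M r j)

/-- Number of nonzero coefficients among the first `r`. -/
def wcnt (x : ℕ → ℕ) : ℕ → ℕ
  | 0 => 0
  | r + 1 => wcnt x r + if x r = 0 then 0 else 1

/-- The multiples of row `i` of `M`, packed. -/
def packRow (m : ℕ) (M : ℕ → ℕ → ℕ) (i a : ℕ) : ℕ := pk (List.range m) fun j => mul4 a (M i j)

def rowsOf (m : ℕ) (M : ℕ → ℕ → ℕ) (r n : ℕ) : List (ℕ × ℕ × ℕ) :=
  (List.range' r n).map fun i => (packRow m M i 1, packRow m M i 2, packRow m M i 3)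

def ones (m : ℕ) : ℕ := (16 ^ m - 1) / 15

def leafW (m d acc w : ℕ) : Bool :=
  or (Nat.beq w 0) (Nat.ble (d + eqTo (ones m) acc 0 % 15) (w + m))

/-- Check all combinations with at most `k` further nonzero coefficients. -/
def chk (m d : ℕ) (rows : List (ℕ × ℕ × ℕ)) : ℕ → ℕ → ℕ → Bool :=
  List.rec (motive := fun _ => ℕ → ℕ → ℕ → Bool) (fun _ acc w => leafW m d acc w)
    (fun R _ ih k acc w => Nat.rec (leafW m d acc w) (fun k' _ =>
      and (ih (k' + 1) acc w) (and (ih k' (Nat.xor acc R.1) (w + 1))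
        (and (ih k' (Nat.xor acc R.2.1) (w + 1)) (ih k' (Nat.xor acc R.2.2) (w + 1))))) k) rows

def word10a : List ℕ := [3, 2, 3, 3, 1, 1, 2, 1, 0, 0]

def rows10a : List (ℕ × ℕ × ℕ) := [
  (303117091, 589435185, 825434642),
  (4849873456, 9430962960, 13206954272),
  (77597975296, 150895407360, 211311268352),
  (142055976961, 215303262210, 82445410307),
  (73872375826, 146317312035, 219614937137),
  (82446385441, 142053737010, 215304110867),
  (219630539281, 73836536610, 146330890547),
  (215553745171, 81872957985, 142270993202),
  (150325039411, 210455699985, 77312635682),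
  (206177375026, 68756316435, 137490543137)]

def word10b : List ℕ := [1, 0, 0, 2, 3, 2, 2, 1, 1, 3]

def rows10b : List (ℕ × ℕ × ℕ) := [
  (210757689345, 77899837442, 151147122691),
  (73588146195, 146885771297, 219330707506),
  (77898711345, 151149085202, 210756436771),
  (146867753745, 219362107682, 73568105011),
  (150860804370, 211258839587, 77578052401),
  (214749614370, 81606550067, 141737210641),
  (137458946595, 206193173297, 68772114706),
  (319889970, 555889427, 842207521),
  (5118239520, 8894230832, 13475320336),
  (81891832320, 142307693312, 215605125376)]

def word12a : List ℕ := [3, 2, 3, 2, 2, 1, 1, 1, 0, 1, 0, 0]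

def rows12a : List (ℕ × ℕ × ℕ) := [
  (69005878051, 138011685169, 207017284114),
  (1104094048816, 2208186962704, 3312276545824),
  (17665504781056, 35330991403264, 52996424733184),
  (1173099786241, 2345909030914, 3517865598979),
  (18769596579856, 37534544494624, 56285849583664),
  (18838568567041, 37602758492674, 56148663206659),
  (19942120362001, 38694182461474, 53953681174579),
  (37598949081361, 56156965962274, 18833968661299),
  (38633231880466, 54086525264419, 19868521870129),
  (55181756666146, 20959474098739, 36421373211409),
  (38483176526371, 53876608869169, 19792017961234),
  (52780871000626, 17600811774739, 35197310669089)]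

def word12b : List ℕ := [3, 2, 2, 1, 3, 0, 1, 0, 0, 2, 2, 3]

def rows12b : List (ℕ × ℕ × ℕ) := [
  (55113037320739, 21096912986929, 36352653668626),
  (37383666999859, 56075631080209, 18692505276706),
  (35188718576434, 52785167151379, 17605107716641),
  (69543801634, 137744290099, 206746755601),
  (1112700826144, 2203908641584, 3307948089616),
  (17803213218304, 35262538265344, 52927169433856),
  (3376434782209, 1250658824194, 2409780809731),
  (54022956515344, 20010541187104, 38556492955696),
  (19942374113539, 38693682283009, 53953933869826),
  (37603009105969, 56148963106834, 18838011785251),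
  (38698192274194, 53958479577379, 19933211853361),
  (56221122965794, 18910743106099, 37456412943121)]

theorem rows10a_eq : rows10a = rowsOf 10 (circ word10a 10) 0 10 := by decide +kernel

theorem chk10a : chk 10 8 rows10a 3 0 0 = true := by decide +kernel

theorem rows10b_eq : rows10b = rowsOf 10 (circ word10b 10) 0 10 := by decide +kernel

theorem chk10b : chk 10 8 rows10b 3 0 0 = true := by decide +kernel

theorem rows12a_eq : rows12a = rowsOf 12 (circ word12a 12) 0 12 := by decide +kernel

theorem chk12a : chk 12 9 rows12a 4 0 0 = true := by decide +kernel

theorem rows12b_eq : rows12b = rowsOf 12 (circ word12b 12) 0 12 := by decide +kernel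

theorem chk12b : chk 12 9 rows12b 4 0 0 = true := by decide +kernel

theorem inv10 : ∀ i < 10, ∀ j < 10,
    out (circ word10b 10) (fun k => circ word10a 10 i k) 10 j = if i = j then 1 else 0 := by
  decide +kernel

theorem inv12 : ∀ i < 12, ∀ j < 12,
    out (circ word12b 12) (fun k => circ word12a 12 i k) 12 j = if i = j then 1 else 0 := by
  decide +kernel

theorem out_lt (M : ℕ → ℕ → ℕ) (x : ℕ → ℕ) (r j : ℕ) : out M x r j < 4 := by
  cases r with
  | zero => simp [out]
  | succ r =>
    induction r with
    | zero => exact xor_lt4 (by norm_num [out]) (mul4_lt _ _)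
    | succ r ih => exact xor_lt4 ih (mul4_lt _ _)

theorem out_stable (M : ℕ → ℕ → ℕ) (x : ℕ → ℕ) (r n : ℕ) (h : wcnt x (r + n) ≤ wcnt x r) :
    out M x (r + n) = out M x r ∧ wcnt x (r + n) = wcnt x r := by
  induction n with
  | zero => simp
  | succ n ih =>
    have e : wcnt x (r + (n + 1)) = wcnt x (r + n) + if x (r + n) = 0 then 0 else 1 := rfl
    rw [e] at h ⊢
    obtain ⟨h1, h2⟩ := ih (by omega)
    have hx : x (r + n) = 0 := by
      by_contra H
      rw [if_neg H] at h
      omega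
    rw [if_pos hx]
    refine ⟨?_, by omega⟩
    funext j
    show out M x (r + n) j ^^^ mul4 (x (r + n)) (M (r + n) j) = _
    rw [h1, hx]
    exact Nat.xor_zero _

theorem out_pack (m : ℕ) (M : ℕ → ℕ → ℕ) (x : ℕ → ℕ) (r : ℕ) :
    Nat.xor (pk (List.range m) (out M x r)) (packRow m M r (x r)) =
      pk (List.range m) (out M x (r + 1)) := by
  unfold packRow
  rw [pk_xor]
  · rfl
  · intro j _
    have := out_lt M x r j
    omega
  · intro j _
    have := mul4_lt (x r) (M r j)
    omega

theorem chk_sound (m d : ℕ) (M : ℕ → ℕ → ℕ) (x : ℕ → ℕ) (hx : ∀ i, x i < 4) (n : ℕ) :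
    ∀ r k, r + n = m → wcnt x m ≤ wcnt x r + k →
      chk m d (rowsOf m M r n) k (pk (List.range m) (out M x r)) (wcnt x r) = true →
      leafW m d (pk (List.range m) (out M x m)) (wcnt x m) = true := by
  induction n with
  | zero =>
    intro r k hr _ h
    have : r = m := by omega
    subst this
    exact h
  | succ n ih =>
    intro r k hr hw h
    have e : rowsOf m M r (n + 1) = (packRow m M r 1, packRow m M r 2, packRow m M r 3) ::
        rowsOf m M (r + 1) n := by
      unfold rowsOf
      rw [List.range'_succ, List.map_cons]
    rw [e] at h
    cases k with
    | zero =>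
      subst hr
      obtain ⟨h1, h2⟩ := out_stable M x r (n + 1) (by omega)
      rw [h1, h2]
      exact h
    | succ k =>
      have h' : (chk m d (rowsOf m M (r + 1) n) (k + 1) (pk (List.range m) (out M x r)) (wcnt x r) &&
        (chk m d (rowsOf m M (r + 1) n) k (Nat.xor (pk (List.range m) (out M x r))
          (packRow m M r 1)) (wcnt x r + 1) &&
        (chk m d (rowsOf m M (r + 1) n) k (Nat.xor (pk (List.range m) (out M x r))
          (packRow m M r 2)) (wcnt x r + 1) &&
        chk m d (rowsOf m M (r + 1) n) k (Nat.xor (pk (List.range m) (out M x r))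
          (packRow m M r 3)) (wcnt x r + 1)))) = true := h
      simp only [Bool.and_eq_true] at h'
      obtain ⟨c0, c1, c2, c3⟩ := h'
      have ew : wcnt x (r + 1) = wcnt x r + if x r = 0 then 0 else 1 := rfl
      have hp := out_pack m M x r
      by_cases h0 : x r = 0
      · rw [if_pos h0, add_zero] at ew
        have hz : out M x (r + 1) = out M x r := (out_stable M x r 1 (by omega)).1
        rw [← hz, ← ew] at c0
        exact ih (r + 1) (k + 1) (by omega) (by omega) c0
      · rw [if_neg h0] at ew
        apply ih (r + 1) k (by omega) (by omega)
        rw [ew, ← hp]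
        have := hx r
        obtain h1 | h1 | h1 : x r = 1 ∨ x r = 2 ∨ x r = 3 := by omega
        · rw [h1]; exact c1
        · rw [h1]; exact c2
        · rw [h1]; exact c3

theorem pk_mod {α : Type} (fs : List α) (g : α → ℕ) : pk fs g % 15 = (fs.map g).sum % 15 := by
  induction fs with
  | nil => rfl
  | cons f fs ih =>
    rw [pk_cons, List.map_cons, List.sum_cons]
    omega

theorem leafW_sound (m d : ℕ) (hm : m < 15) (ho : ones m = pk (List.range m) fun _ => 1)
    (y : ℕ → ℕ) (hy : ∀ j, y j < 4) (w : ℕ) (hw : w ≠ 0)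
    (h : leafW m d (pk (List.range m) y) w = true) :
    d + ((Finset.range m).filter fun j => y j = 0).card ≤ w + m := by
  unfold leafW at h
  rw [ho, eqTo_pk _ _ _ _ (by norm_num) (fun _ _ => le_rfl) (fun j _ => hy j), pk_mod] at h
  have e : ((List.range m).map fun j => if 1 = 1 ∧ y j = 0 then 1 else 0).sum =
      ((Finset.range m).filter fun j => y j = 0).card := by
    rw [Finset.card_filter]
    simp only [true_and]
    rfl
  rw [e, Nat.mod_eq_of_lt] at h
  · rw [Bool.or_eq_true] at h
    rcases h with h | h
    · exact absurd (Nat.eq_of_beq_eq_true h) hw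
    · exact Nat.le_of_ble_eq_true h
  · have := Finset.card_filter_le (Finset.range m) fun j => y j = 0
    rw [Finset.card_range] at this
    omega

section lower
variable {F : Type*} [Field F] {ω : F}

theorem out_toF (hω : Prim ω) (M : ℕ → ℕ → ℕ) (hM : ∀ i j, M i j < 4) (x : ℕ → ℕ)
    (hx : ∀ i, x i < 4) (j : ℕ) (r : ℕ) :
    toF ω (out M x r j) = ∑ i ∈ Finset.range r, toF ω (x i) * toF ω (M i j) := by
  induction r with
  | zero => simp [out, toF]
  | succ r ih =>
    have e : out M x (r + 1) j = out M x r j ^^^ mul4 (x r) (M r j) := rfl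
    rw [e, hω.xor (out_lt _ _ _ _) (mul4_lt _ _), hω.mul (hx r) (hM r j), ih,
      Finset.sum_range_succ]

theorem wcnt_card (x : ℕ → ℕ) (r : ℕ) :
    wcnt x r = ((Finset.range r).filter fun i => x i ≠ 0).card := by
  induction r with
  | zero => rfl
  | succ r ih =>
    rw [Finset.card_filter, Finset.sum_range_succ, ← Finset.card_filter, ← ih]
    show wcnt x r + _ = _
    congr 1
    by_cases h : x r = 0 <;> simp [h]

/-- The matrix over `F` with the given codes. -/
def toMat (ω : F) (m : ℕ) (M : ℕ → ℕ → ℕ) : Matrix (Fin m) (Fin m) F :=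
  Matrix.of fun i j => toF ω (M i j)

theorem vecMul_toMat (hω : Prim ω) (m : ℕ) (M : ℕ → ℕ → ℕ) (hM : ∀ i j, M i j < 4) (x : ℕ → ℕ)
    (hx : ∀ i, x i < 4) (j : Fin m) :
    Matrix.vecMul (fun i : Fin m => toF ω (x i)) (toMat ω m M) j = toF ω (out M x m j) := by
  rw [out_toF hω M hM x hx, ← Fin.sum_univ_eq_sum_range (fun i => toF ω (x i) * toF ω (M i j)) m]
  rfl

theorem wt_toF (hω : Prim ω) (m : ℕ) (x : ℕ → ℕ) (hx : ∀ i, x i < 4) :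
    wt (fun i : Fin m => toF ω (x i)) = ((Finset.range m).filter fun i => x i ≠ 0).card := by
  classical
  rw [wt_eq, Finset.card_filter, Finset.card_filter,
    ← Fin.sum_univ_eq_sum_range (fun i => if x i ≠ 0 then 1 else 0) m]
  simp only [ne_eq, hω.zero_iff (hx _)]

theorem low_weight (hω : Prim ω) (m d k : ℕ) (hm : m < 15)
    (ho : ones m = pk (List.range m) fun _ => 1) (M : ℕ → ℕ → ℕ) (hM : ∀ i j, M i j < 4)
    (hc : chk m d (rowsOf m M 0 m) k 0 0 = true) (x : Fin m → F) (hx : x ≠ 0) (hk : wt x ≤ k) :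
    d ≤ wt x + wt (Matrix.vecMul x (toMat ω m M)) := by
  choose c hc4 hcx using fun i : ℕ => hω.surj (if h : i < m then x ⟨i, h⟩ else 0)
  have ex : x = fun i : Fin m => toF ω (c i) := by
    funext i
    rw [hcx, dif_pos i.2]
  have ey : Matrix.vecMul x (toMat ω m M) = fun j : Fin m => toF ω (out M c m j) := by
    funext j
    rw [ex]
    exact vecMul_toMat hω m M hM c hc4 j
  have w1 : wt x = wcnt c m := by rw [ex, wt_toF hω m c hc4, wcnt_card]
  have w2 : wt (Matrix.vecMul x (toMat ω m M)) +
      ((Finset.range m).filter fun j => out M c m j = 0).card = m := by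
    rw [ey, wt_toF hω m _ (out_lt M c m)]
    have := Finset.card_filter_add_card_filter_not (s := Finset.range m)
      (fun j => out M c m j = 0)
    rw [Finset.card_range] at this
    simp only [ne_eq]
    omega
  have hw0 : wcnt c m ≠ 0 := by
    intro H
    rw [wcnt_card, Finset.card_eq_zero, Finset.filter_eq_empty_iff] at H
    apply hx
    rw [ex]
    funext i
    have := H (Finset.mem_range.2 i.2)
    simp only [ne_eq, not_not] at this
    rw [this, toF0]
    rfl
  have hz : pk (List.range m) (out M c 0) = 0 := pk_zero _
  have h1 := chk_sound m d M c hc4 m 0 k (by omega) (by rw [← w1]; show _ ≤ 0 + k; omega)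
    (by rw [hz]; exact hc)
  have h2 := leafW_sound m d hm ho _ (out_lt M c m) _ hw0 h1
  omega

theorem lo_of (hω : Prim ω) (m d k : ℕ) (hm : m < 15)
    (ho : ones m = pk (List.range m) fun _ => 1) (t t' : List ℕ) (ht : ∀ a ∈ t, a < 4)
    (ht' : ∀ a ∈ t', a < 4) (hk : d ≤ 2 * k + 2)
    (h1 : chk m d (rowsOf m (circ t m) 0 m) k 0 0 = true)
    (h2 : chk m d (rowsOf m (circ t' m) 0 m) k 0 0 = true)
    (hi : ∀ i < m, ∀ j < m, out (circ t' m) (fun k => circ t m i k) m j = if i = j then 1 else 0) :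
    Lo F m d := by
  have hlt : ∀ t : List ℕ, (∀ a ∈ t, a < 4) → ∀ i j, circ t m i j < 4 := by
    intro t ht i j
    unfold circ
    by_cases h : (j + m - i) % m < t.length
    · rw [List.getD_eq_getElem _ _ h]
      exact ht _ (List.getElem_mem _)
    · rw [List.getD_eq_default _ _ (by omega)]
      norm_num
  have hAB : toMat ω m (circ t m) * toMat ω m (circ t' m) = 1 := by
    ext i j
    have e := vecMul_toMat hω m (circ t' m) (hlt t' ht') (fun k => circ t m i k)
      (fun k => hlt t ht i k) j
    rw [hi i i.2 j j.2] at e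
    rw [Matrix.one_apply]
    refine Eq.trans e ?_
    by_cases h : i = j
    · rw [if_pos h, if_pos (by rw [h]), toF1]
    · rw [if_neg h, if_neg (fun H => h (Fin.ext H)), toF0]
  refine ⟨toMat ω m (circ t m), ?_, ?_⟩
  · intro i j i' j' h
    have := i.2
    have := i'.2
    show toF ω (circ t m i j) = toF ω (circ t m i' j')
    unfold circ
    rw [show (j : ℕ) + m - i = j' + m - i' by omega]
  · intro x hx
    set y := Matrix.vecMul x (toMat ω m (circ t m)) with hy
    have hyx : Matrix.vecMul y (toMat ω m (circ t' m)) = x := by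
      rw [hy, Matrix.vecMul_vecMul, hAB, Matrix.vecMul_one]
    by_cases hwx : wt x ≤ k
    · exact low_weight hω m d k hm ho _ (hlt t ht) h1 x hx hwx
    · by_cases hwy : wt y ≤ k
      · have hy0 : y ≠ 0 := by
          intro H
          rw [H, Matrix.zero_vecMul] at hyx
          exact hx hyx.symm
        have := low_weight hω m d k hm ho _ (hlt t' ht') h2 y hy0 hwy
        rw [hyx] at this
        omega
      · omega

theorem lo10 (hω : Prim ω) : Lo F 10 8 :=
  lo_of hω 10 8 3 (by norm_num) (by decide +kernel) word10a word10b (by decide) (by decide)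
    (by norm_num) (by rw [← rows10a_eq]; exact chk10a) (by rw [← rows10b_eq]; exact chk10b) inv10

theorem lo12 (hω : Prim ω) : Lo F 12 9 :=
  lo_of hω 12 9 4 (by norm_num) (by decide +kernel) word12a word12b (by decide) (by decide)
    (by norm_num) (by rw [← rows12a_eq]; exact chk12a) (by rw [← rows12b_eq]; exact chk12b) inv12

end lower

/-- `d_{4,DT}(16) = 6`, `d_{4,DT}(18) = 7`, `d_{4,DT}(20) = 8`,
`d_{4,DT}(22) = 8` and `d_{4,DT}(24) = 9`. -/
theorem stmt19 (F : Type*) [Field F] [Fintype F] (hF : Fintype.card F = 4) :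
    DTlargestEq F 8 6 ∧ DTlargestEq F 9 7 ∧ DTlargestEq F 10 8 ∧
      DTlargestEq F 11 8 ∧ DTlargestEq F 12 9 := by
  obtain ⟨ω, hω⟩ := exists_prim hF
  have u8 := up8 hω
  have u11 := up11 hω
  have l10 := lo10 hω
  have l12 := lo12 hω
  exact ⟨largest_of u8 l10.pred.pred, largest_of u8.succ l10.pred, largest_of u8.succ.succ l10,
    largest_of u11 l12.pred, largest_of u11.succ l12⟩
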